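/- arXiv:2305.14170 — 4 statements merged into one kernel-verified Lean document; each statement's English description precedes it below -/
import Mathlib

section
/- For all integers m ≥ 1, d ≥ 1 and n ≥ 0, the map η sending an m-regular d-contact stack S on [n] to the path η(S) = P_1 P_2 ⋯ P_n, where P_v = D^{ldeg(v)} L^{d − ldeg(v) − rdeg(v)} U^{rdeg(v)} for each vertex v, is a bijection from the set of m-regular d-contact stacks on [n] onto the set of m-regular Λ-avoiding DLU paths of length dn from (0,0) to (dn,0). In particular s_{m,d}(n) = g^{⟨0,0⟩}_{m,d}(dn). -/
/-- A step of a lattice path: up `(1,1)`, down `(1,-1)`, or horizontal `(1,0)`. -/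
inductive DStep : Type
  | U : DStep
  | D : DStep
  | L : DStep
  deriving DecidableEq

/-- The vertical displacement of a step. -/
def DStep.val : DStep → ℤ
  | .U => 1
  | .D => -1
  | .L => 0

/-- Total vertical displacement of a word of steps. -/
def stepSum (w : List DStep) : ℤ := (w.map DStep.val).sum

/-- A word of the form `D^a L^b U^c` with `a + b + c = d`. -/
def IsPieceWord (d : ℕ) (p : List DStep) : Prop :=
  ∃ a b c : ℕ, a + b + c = d ∧
    p = List.replicate a DStep.D ++ List.replicate b DStep.L ++ List.replicate c DStep.U

/-- `M` is a DLU path of length `d*n` from `(0,s)` to `(d*n,t)`: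
each consecutive block (piece) of `d` steps has the form `D^a L^b U^c`,
the path starts at height `s`, ends at height `t`, and never passes below the x-axis. -/
def IsDLUPath (d n s t : ℕ) (M : List DStep) : Prop :=
  M.length = d * n ∧
  (∀ i < n, IsPieceWord d ((M.drop (d * i)).take d)) ∧
  (s : ℤ) + stepSum M = (t : ℤ) ∧
  ∀ k ≤ M.length, 0 ≤ (s : ℤ) + stepSum (M.take k)

/-- The completed path `M̂ = L^{d-s} U^s M D^t L^{d-t}`. -/
def hatPath (d s t : ℕ) (M : List DStep) : List DStep :=
  List.replicate (d - s) DStep.L ++ List.replicate s DStep.U ++ M ++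
    List.replicate t DStep.D ++ List.replicate (d - t) DStep.L

/-- `w` contains a contiguous subpath `U P D` with `P ∈ {∅, L^d, L^{2d}, …, L^{(m-2)d}}`. -/
def HasShortUD (m d : ℕ) (w : List DStep) : Prop :=
  ∃ k : ℕ, k + 2 ≤ m ∧
    ([DStep.U] ++ List.replicate (k * d) DStep.L ++ [DStep.D]) <:+: w

/-- `w` is `m`-regular: it contains no subpath `U P D` with
`P ∈ {∅, L^d, L^{2d}, …, L^{(m-2)d}}`. -/
def RegularWord (m d : ℕ) (w : List DStep) : Prop := ¬ HasShortUD m d w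

/-- `w` has pattern `Λ`: it contains a contiguous subpath `U U P D D` in which the two `U`'s
lie in a common piece (block of `d` steps), the two `D`'s lie in a common piece, and `P`
starts and ends at the same height `h` and never passes below height `h`. -/
def HasLambda (d : ℕ) (w : List DStep) : Prop :=
  ∃ pre P suf : List DStep,
    w = pre ++ [DStep.U, DStep.U] ++ P ++ [DStep.D, DStep.D] ++ suf ∧
    (pre.length + 1) % d ≠ 0 ∧
    (pre.length + P.length + 3) % d ≠ 0 ∧
    stepSum P = 0 ∧
    (∀ k ≤ P.length, 0 ≤ stepSum (P.take k))

/-- An `m`-regular `Λ`-avoiding DLU path of length `d*n` from `(0,s)` to `(d*n,t)`: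
the regularity and `Λ`-avoidance conditions are imposed on the completed path `M̂`. -/
def IsGoodPath (m d n s t : ℕ) (M : List DStep) : Prop :=
  IsDLUPath d n s t M ∧ RegularWord m d (hatPath d s t M) ∧ ¬ HasLambda d (hatPath d s t M)

/-- A prime path: an `m`-regular `Λ`-avoiding DLU path which never touches the x-axis. -/
def IsPrimePath (m d n s t : ℕ) (M : List DStep) : Prop :=
  IsGoodPath m d n s t M ∧ ∀ k ≤ M.length, 0 < (s : ℤ) + stepSum (M.take k)

/-- `g^{⟨s,t⟩}_{m,d}(dn)`: the number of `m`-regular `Λ`-avoiding DLU paths of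
length `d*n` from `(0,s)` to `(d*n,t)`. -/
noncomputable def gCount (m d n s t : ℕ) : ℕ := {M : List DStep | IsGoodPath m d n s t M}.ncard

/-- `a^{⟨s,t⟩}_{m,d}(dn)`: the number of prime `m`-regular `Λ`-avoiding DLU paths of
length `d*n` from `(0,s)` to `(d*n,t)`. -/
noncomputable def aCount (m d n s t : ℕ) : ℕ := {M : List DStep | IsPrimePath m d n s t M}.ncard

/-- The generating function `G^{⟨s,t⟩}_{m,d}(x) = Σ_{n≥0} g^{⟨s,t⟩}_{m,d}(dn) x^{dn}`. -/
noncomputable def Gps (m d s t : ℕ) : PowerSeries ℤ :=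
  PowerSeries.mk fun N => if d ∣ N then (gCount m d (N / d) s t : ℤ) else 0

/-- The generating function `A^{⟨s,t⟩}_{m,d}(x) = Σ_{n≥0} a^{⟨s,t⟩}_{m,d}(dn) x^{dn}`. -/
noncomputable def Aps (m d s t : ℕ) : PowerSeries ℤ :=
  PowerSeries.mk fun N => if d ∣ N then (aCount m d (N / d) s t : ℤ) else 0

/-- `C_{m,d}(x) = (x^{d(m-1)} - 1)/(x^d - 1) = Σ_{k=0}^{m-2} x^{dk}`. -/
noncomputable def Cps (m d : ℕ) : PowerSeries ℤ :=
  ∑ k ∈ Finset.range (m - 1), (PowerSeries.X : PowerSeries ℤ) ^ (d * k)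

/-- `S` is a `d`-contact stack on `[n]`: a set of arcs `(i,j)` with `1 ≤ i < j ≤ n`,
noncrossing, in which every vertex lies in at most `d` arcs. -/
def IsContactStack (d n : ℕ) (S : Finset (ℕ × ℕ)) : Prop :=
  (∀ p ∈ S, 1 ≤ p.1 ∧ p.1 < p.2 ∧ p.2 ≤ n) ∧
  (∀ p ∈ S, ∀ q ∈ S, ¬ (p.1 < q.1 ∧ q.1 < p.2 ∧ p.2 < q.2)) ∧
  (∀ v : ℕ, (S.filter fun p => p.1 = v ∨ p.2 = v).card ≤ d)

/-- Every arc of `S` has length at least `m`. -/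
def ArcsRegular (m : ℕ) (S : Finset (ℕ × ℕ)) : Prop := ∀ p ∈ S, m ≤ p.2 - p.1

/-- `S` is an `m`-regular `d`-contact stack on `[n]`. -/
def IsStack (m d n : ℕ) (S : Finset (ℕ × ℕ)) : Prop :=
  IsContactStack d n S ∧ ArcsRegular m S

/-- The left degree of vertex `v`: the number of arcs ending at `v`. -/
def ldeg (S : Finset (ℕ × ℕ)) (v : ℕ) : ℕ := (S.filter fun p => p.2 = v).card

/-- The right degree of vertex `v`: the number of arcs starting at `v`. -/
def rdeg (S : Finset (ℕ × ℕ)) (v : ℕ) : ℕ := (S.filter fun p => p.1 = v).card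

/-- The map `η`, sending a stack `S` on `[n]` to the word `P_1 P_2 ⋯ P_n` where
`P_v = D^{ldeg v} L^{d - ldeg v - rdeg v} U^{rdeg v}`. -/
def eta (d n : ℕ) (S : Finset (ℕ × ℕ)) : List DStep :=
  (List.range n).flatMap fun i =>
    List.replicate (ldeg S (i + 1)) DStep.D ++
      List.replicate (d - ldeg S (i + 1) - rdeg S (i + 1)) DStep.L ++
      List.replicate (rdeg S (i + 1)) DStep.U

/-- `s_{m,d}(n)`: the number of `m`-regular `d`-contact stacks on `[n]`. -/
noncomputable def sCount (m d n : ℕ) : ℕ := {S : Finset (ℕ × ℕ) | IsStack m d n S}.ncard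

/-- The generating function `S_{m,d}(x) = Σ_{n≥0} s_{m,d}(n) xⁿ`. -/
noncomputable def Sps (m d : ℕ) : PowerSeries ℤ := PowerSeries.mk fun n => (sCount m d n : ℤ)

namespace Stk

theorem stepSum_append (x y : List DStep) : stepSum (x ++ y) = stepSum x + stepSum y := by
  simp [stepSum]

theorem stepSum_replicate (k : ℕ) (x : DStep) : stepSum (List.replicate k x) = k * x.val := by
  simp [stepSum]

/-- The word of one vertex. -/
def piece (d a c : ℕ) : List DStep :=
  List.replicate a DStep.D ++ List.replicate (d - a - c) DStep.L ++ List.replicate c DStep.U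

/-- The word with left degrees `l` and right degrees `r`. -/
def W (d : ℕ) (l r : ℕ → ℕ) (N : ℕ) : List DStep :=
  (List.range N).flatMap fun i => piece d (l i) (r i)

theorem piece_length {d a c : ℕ} (h : a + c ≤ d) : (piece d a c).length = d := by
  simp [piece]; omega

theorem piece_get {d a c s : ℕ} (h : a + c ≤ d) (hs : s < d) :
    (piece d a c)[s]? =
      some (if s < a then DStep.D else if s < d - c then DStep.L else DStep.U) := by
  unfold piece
  simp only [List.getElem?_append, List.length_append, List.length_replicate,
    List.getElem?_replicate]
  split_ifs <;> first | rfl | omega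

theorem piece_sum {d a c s : ℕ} (h : a + c ≤ d) (hs : s ≤ d) :
    stepSum ((piece d a c).take s) = -((min s a : ℕ) : ℤ) + ((s - (d - c) : ℕ) : ℤ) := by
  unfold piece
  simp only [List.take_append, List.length_append, List.length_replicate,
    List.take_replicate, stepSum_append, stepSum_replicate, DStep.val]
  have : min (s - (a + (d - a - c))) c = s - (d - c) := by omega
  rw [this]; ring

theorem W_succ (d : ℕ) (l r : ℕ → ℕ) (N : ℕ) :
    W d l r (N + 1) = W d l r N ++ piece d (l N) (r N) := by
  simp [W, List.range_succ]

theorem W_length {d : ℕ} {l r : ℕ → ℕ} (h : ∀ i, l i + r i ≤ d) (N : ℕ) :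
    (W d l r N).length = d * N := by
  induction N with
  | zero => simp [W]
  | succ N ih => rw [W_succ, List.length_append, ih, piece_length (h N)]; ring

theorem W_split (d : ℕ) (l r : ℕ → ℕ) {i N : ℕ} (hi : i < N) :
    ∃ rest, W d l r N = W d l r i ++ (piece d (l i) (r i) ++ rest) := by
  induction N with
  | zero => omega
  | succ N ih =>
    rcases Nat.lt_succ_iff_lt_or_eq.mp hi with h | h
    · obtain ⟨rest, hr⟩ := ih h
      exact ⟨rest ++ piece d (l N) (r N), by rw [W_succ, hr]; simp⟩
    · subst h
      exact ⟨[], by rw [W_succ]; simp⟩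

theorem W_block {d : ℕ} {l r : ℕ → ℕ} (h : ∀ i, l i + r i ≤ d) {i N : ℕ} (hi : i < N) :
    ((W d l r N).drop (d * i)).take d = piece d (l i) (r i) := by
  obtain ⟨rest, hr⟩ := W_split d l r hi
  rw [hr, List.drop_append, List.take_append]
  simp [W_length h, piece_length (h i), List.drop_eq_nil_of_le, List.take_of_length_le]

theorem W_get {d : ℕ} {l r : ℕ → ℕ} (h : ∀ i, l i + r i ≤ d) {i N s : ℕ} (hi : i < N)
    (hs : s < d) :
    (W d l r N)[d * i + s]? =
      some (if s < l i then DStep.D else if s < d - r i then DStep.L else DStep.U) := by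
  obtain ⟨rest, hr⟩ := W_split d l r hi
  rw [hr, List.getElem?_append_right (by rw [W_length h]; omega), W_length h,
    Nat.add_sub_cancel_left, List.getElem?_append_left (by rw [piece_length (h i)]; omega),
    piece_get (h i) hs]

/-- Height at the beginning of vertex `i`. -/
def bal (l r : ℕ → ℕ) (i : ℕ) : ℤ := ∑ u ∈ Finset.range i, ((r u : ℤ) - l u)

theorem W_sum {d : ℕ} {l r : ℕ → ℕ} (h : ∀ i, l i + r i ≤ d) (N : ℕ) :
    stepSum (W d l r N) = bal l r N := by
  induction N with
  | zero => simp [W, bal, stepSum]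
  | succ N ih =>
    rw [W_succ, stepSum_append, ih, bal, bal, Finset.sum_range_succ]
    have := piece_sum (h N) (le_refl d)
    rw [List.take_of_length_le (by rw [piece_length (h N)])] at this
    have h1 := h N
    rw [this]; omega

theorem W_height {d : ℕ} {l r : ℕ → ℕ} (h : ∀ i, l i + r i ≤ d) {i N s : ℕ} (hi : i < N)
    (hs : s ≤ d) :
    stepSum ((W d l r N).take (d * i + s)) =
      bal l r i - ((min s (l i) : ℕ) : ℤ) + ((s - (d - r i) : ℕ) : ℤ) := by
  obtain ⟨rest, hr⟩ := W_split d l r hi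
  rw [hr, List.take_append, List.take_append, stepSum_append, stepSum_append,
    List.take_of_length_le (by rw [W_length h]; omega), W_length h, W_sum h,
    Nat.add_sub_cancel_left, piece_length (h i), piece_sum (h i) hs, Nat.sub_eq_zero_of_le hs]
  simp [stepSum]; ring

theorem bal_succ (l r : ℕ → ℕ) (i : ℕ) : bal l r (i + 1) = bal l r i + r i - l i := by
  simp [bal, Finset.sum_range_succ]; ring

/-- positional form of the pattern. -/
def LambdaPos (d : ℕ) (w : List DStep) (p q : ℕ) : Prop :=
  p + 2 ≤ q ∧ w[p]? = some DStep.U ∧ w[p+1]? = some DStep.U ∧ w[q]? = some DStep.D ∧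
  w[q+1]? = some DStep.D ∧ (p + 1) % d ≠ 0 ∧ (q + 1) % d ≠ 0 ∧
  stepSum (w.take q) = stepSum (w.take (p+2)) ∧
  ∀ k, p + 2 ≤ k → k ≤ q → stepSum (w.take (p+2)) ≤ stepSum (w.take k)

theorem two_split {w : List DStep} {p : ℕ} {x y : DStep} (h1 : w[p]? = some x)
    (h2 : w[p+1]? = some y) : w.drop p = x :: y :: w.drop (p+2) := by
  rw [List.drop_eq_getElem_cons (by rw [List.getElem?_eq_some_iff] at h1; exact h1.1),
    List.drop_eq_getElem_cons (by rw [List.getElem?_eq_some_iff] at h2; exact h2.1)]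
  rw [List.getElem?_eq_some_iff] at h1 h2
  obtain ⟨_, h1⟩ := h1
  obtain ⟨_, h2⟩ := h2
  simp [h1, h2]

theorem hasLambda_iff (d : ℕ) (w : List DStep) : HasLambda d w ↔ ∃ p q, LambdaPos d w p q := by
  constructor
  · rintro ⟨pre, P, suf, hw, h1, h2, h3, h4⟩
    have hk : ∀ k ≤ P.length, stepSum (w.take (pre.length + 2 + k)) =
        stepSum (pre ++ [DStep.U, DStep.U]) + stepSum (P.take k) := by
      intro k hk
      rw [← stepSum_append]
      congr 1
      have : w = (pre ++ [DStep.U, DStep.U]) ++ (P ++ ([DStep.D, DStep.D] ++ suf)) := by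
        rw [hw]; simp
      have e1 : (pre ++ [DStep.U, DStep.U]).length = pre.length + 2 := by simp
      rw [this, ← e1, List.take_length_add_append, List.take_append_of_le_length hk]
    refine ⟨pre.length, pre.length + 2 + P.length, by omega, ?_, ?_, ?_, ?_, h1, ?_, ?_, ?_⟩
    · rw [hw]; simp
    · rw [hw]; simp
    · rw [hw, List.append_assoc, List.getElem?_append_right (by simp; omega)]
      have : pre.length + 2 + P.length - (pre ++ [DStep.U, DStep.U] ++ P).length = 0 := by
        simp; omega
      rw [this]; simp
    · rw [hw, List.append_assoc, List.getElem?_append_right (by simp; omega)]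
      have : pre.length + 2 + P.length + 1 - (pre ++ [DStep.U, DStep.U] ++ P).length = 1 := by
        simp; omega
      rw [this]; simp
    · convert h2 using 2; omega
    · have := hk 0 (by omega)
      rw [Nat.add_zero] at this
      rw [hk _ le_rfl, this, List.take_length, h3]; simp [stepSum]
    · intro k hk1 hk2
      obtain ⟨k, rfl⟩ := Nat.exists_eq_add_of_le hk1
      have := hk 0 (by omega)
      rw [Nat.add_zero] at this
      rw [hk _ (by omega), this]
      have := h4 k (by omega)
      simp [stepSum] at *; omega
  · rintro ⟨p, q, hpq, u1, u2, d1, d2, m1, m2, h3, h4⟩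
    have hp : p + 1 < w.length := (List.getElem?_eq_some_iff.mp u2).1
    have hq : q + 1 < w.length := (List.getElem?_eq_some_iff.mp d2).1
    have hA := two_split u1 u2
    have hB := two_split d1 d2
    have hP : ((w.drop (p+2)).take (q - (p+2))).length = q - (p+2) := by simp; omega
    have hT : ∀ k ≤ q - (p+2), stepSum (((w.drop (p+2)).take (q - (p+2))).take k) =
        stepSum (w.take (p + 2 + k)) - stepSum (w.take (p+2)) := by
      intro k hk
      rw [List.take_take, min_eq_left hk, List.take_add, stepSum_append]; ring
    refine ⟨w.take p, (w.drop (p+2)).take (q - (p+2)), w.drop (q+2), ?_, ?_, ?_, ?_, ?_⟩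
    · conv_lhs => rw [← List.take_append_drop p w, hA,
        ← List.take_append_drop (q - (p+2)) (w.drop (p+2)), List.drop_drop,
        show p + 2 + (q - (p+2)) = q by omega, hB]
      simp
    · rw [List.length_take, min_eq_left (by omega)]; exact m1
    · rw [hP, List.length_take, min_eq_left (by omega)]; convert m2 using 2; omega
    · have := hT (q - (p+2)) le_rfl
      rw [List.take_of_length_le (by rw [hP]), show p + 2 + (q - (p+2)) = q by omega] at this
      rw [this, h3]; ring
    · intro k hk
      rw [hP] at hk
      rw [hT k hk]
      have := h4 (p+2+k) (by omega) (by omega)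
      omega

theorem hasShort_iff (m d : ℕ) (w : List DStep) : HasShortUD m d w ↔
    ∃ k p, k + 2 ≤ m ∧ w[p]? = some DStep.U ∧ (∀ t < k * d, w[p+1+t]? = some DStep.L) ∧
      w[p+1+k*d]? = some DStep.D := by
  unfold HasShortUD
  refine exists_congr fun k => ?_
  constructor
  · rintro ⟨hk, pre, suf, hw⟩
    have hw' : w = pre ++ (DStep.U :: (List.replicate (k * d) DStep.L ++ (DStep.D :: suf))) := by
      rw [← hw]; simp
    refine ⟨pre.length, hk, ?_, ?_, ?_⟩
    · rw [hw']; simp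
    · intro t ht
      rw [hw', List.getElem?_append_right (by omega),
        show pre.length + 1 + t - pre.length = t + 1 by omega, List.getElem?_cons_succ,
        List.getElem?_append_left (by simpa using ht)]
      simp [ht]
    · rw [hw', List.getElem?_append_right (by omega),
        show pre.length + 1 + k * d - pre.length = k * d + 1 by omega, List.getElem?_cons_succ,
        List.getElem?_append_right (by simp)]
      simp
  · rintro ⟨p, hk, hu, hl, hd⟩
    refine ⟨hk, w.take p, w.drop (p + 1 + k * d + 1), ?_⟩
    have h1 := (List.getElem?_eq_some_iff.mp hu)
    have h2 := (List.getElem?_eq_some_iff.mp hd)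
    obtain ⟨h1, h1'⟩ := h1
    obtain ⟨h2, h2'⟩ := h2
    have hm : (w.drop (p+1)).take (k*d) = List.replicate (k*d) DStep.L := by
      apply List.ext_getElem?
      intro t
      rw [List.getElem?_take, List.getElem?_replicate]
      split_ifs with ht
      · rw [List.getElem?_drop]; exact hl t ht
      · rfl
    conv_rhs => rw [← List.take_append_drop p w, List.drop_eq_getElem_cons h1, h1',
        ← List.take_append_drop (k*d) (w.drop (p+1)), List.drop_drop, hm,
        List.drop_eq_getElem_cons h2, h2']
    simp

end Stk
namespace Stk

/-- Noncrossing family of arcs `(a t, b t)`, `t ∈ T`. -/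
def NC {ι : Type} (T : Finset ι) (a b : ι → ℕ) : Prop :=
  (∀ t ∈ T, a t < b t) ∧ ∀ t ∈ T, ∀ u ∈ T, ¬ (a t < a u ∧ a u < b t ∧ b t < b u)

/-- Number of indices with value `v`. -/
def deg {ι : Type} (T : Finset ι) (a : ι → ℕ) (v : ℕ) : ℕ := (T.filter fun t => a t = v).card

theorem deg_sum {ι : Type} (T : Finset ι) (a : ι → ℕ) (v : ℕ) :
    (deg T a v : ℤ) = ∑ t ∈ T, if a t = v then 1 else 0 := by
  simp [deg]

theorem bal_sum {ι : Type} (T : Finset ι) (a b : ι → ℕ) (i : ℕ) :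
    bal (deg T b) (deg T a) i =
      ∑ t ∈ T, ((if a t < i then 1 else 0) - (if b t < i then 1 else 0) : ℤ) := by
  induction i with
  | zero => simp [bal]
  | succ i ih =>
    rw [bal_succ, ih, deg_sum, deg_sum, ← Finset.sum_add_distrib, ← Finset.sum_sub_distrib]
    refine Finset.sum_congr rfl fun t _ => ?_
    split_ifs <;> omega

theorem card_sum {ι : Type} (T : Finset ι) (P : ι → Prop) [DecidablePred P] :
    ((T.filter P).card : ℤ) = ∑ t ∈ T, if P t then 1 else 0 := by
  simp

theorem ballot {ι : Type} {T : Finset ι} {a b : ι → ℕ} (h : NC T a b) (i : ℕ) :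
    (deg T b i : ℤ) ≤ bal (deg T b) (deg T a) i := by
  rw [bal_sum, deg_sum]
  refine Finset.sum_le_sum fun t ht => ?_
  have := h.1 t ht
  split_ifs <;> omega

/-- `d*i+s` decomposition -/
theorem dm {d : ℕ} (hd : 1 ≤ d) (p : ℕ) : ∃ i s, s < d ∧ p = d * i + s :=
  ⟨p / d, p % d, Nat.mod_lt _ hd, (Nat.div_add_mod p d).symm⟩

theorem lt_of_pos {d i j s s' : ℕ} (hs : s < d) (h : d * j + s' < d * i + s) : j ≤ i := by
  by_contra hc
  have : d * (i + 1) ≤ d * j := Nat.mul_le_mul_left _ (by omega)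
  rw [Nat.mul_add] at this
  omega

theorem pos_lt {d i j s s' : ℕ} (hs : s ≤ d) (h : i < j) : d * i + s ≤ d * j + s' := by
  have : d * (i + 1) ≤ d * j := Nat.mul_le_mul_left _ h
  rw [Nat.mul_add] at this
  omega

theorem getU {d : ℕ} {l r : ℕ → ℕ} (h : ∀ i, l i + r i ≤ d) {i N s : ℕ} (hi : i < N)
    (hs : s < d) : (W d l r N)[d * i + s]? = some DStep.U ↔ d - r i ≤ s := by
  rw [W_get h hi hs]
  have := h i
  split_ifs <;> simp <;> omega

theorem getD {d : ℕ} {l r : ℕ → ℕ} (h : ∀ i, l i + r i ≤ d) {i N s : ℕ} (hi : i < N)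
    (hs : s < d) : (W d l r N)[d * i + s]? = some DStep.D ↔ s < l i := by
  rw [W_get h hi hs]
  have := h i
  split_ifs <;> simp <;> omega

theorem getL {d : ℕ} {l r : ℕ → ℕ} (h : ∀ i, l i + r i ≤ d) {i N s : ℕ} (hi : i < N)
    (hs : s < d) : (W d l r N)[d * i + s]? = some DStep.L ↔ l i ≤ s ∧ s < d - r i := by
  rw [W_get h hi hs]
  have := h i
  split_ifs <;> simp <;> omega

theorem idx_lt {d : ℕ} {l r : ℕ → ℕ} (h : ∀ i, l i + r i ≤ d) {i N s : ℕ} {x : DStep}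
    (hx : (W d l r N)[d * i + s]? = some x) : i < N := by
  have := (List.getElem?_eq_some_iff.mp hx).1
  rw [W_length h] at this
  by_contra hc
  have : d * N ≤ d * i := Nat.mul_le_mul_left _ (by omega)
  omega

theorem mod_ne {d i s : ℕ} (hs : s < d) (h : (d * i + s + 1) % d ≠ 0) : s + 1 < d := by
  by_contra hc
  have : s + 1 = d := by omega
  rw [add_assoc, this] at h
  simp at h

theorem mod_ne' {d i s : ℕ} (hs : s + 1 < d) : (d * i + s + 1) % d ≠ 0 := by
  rw [add_assoc, Nat.mul_add_mod, Nat.mod_eq_of_lt hs]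
  omega

theorem no_lambda {ι : Type} {T : Finset ι} {a b : ι → ℕ} {d N : ℕ} (hd : 1 ≤ d) (h : NC T a b)
    (hdeg : ∀ i, deg T b i + deg T a i ≤ d)
    (inj : ∀ t ∈ T, ∀ u ∈ T, a t = a u → b t = b u → t = u) :
    ¬ HasLambda d (W d (deg T b) (deg T a) N) := by
  classical
  rw [hasLambda_iff]
  rintro ⟨p, q, hpq, u1, u2, d1, d2, m1, m2, h3, h4⟩
  obtain ⟨i, s, hs, rfl⟩ := dm hd p
  obtain ⟨j, s', hs', rfl⟩ := dm hd q
  have hi := idx_lt hdeg u1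
  have hj := idx_lt hdeg d1
  have hs1 := mod_ne hs m1
  have hs1' := mod_ne hs' m2
  rw [getU hdeg hi hs] at u1
  rw [getD hdeg hj hs'] at d1
  rw [add_assoc, getD hdeg hj hs1'] at d2
  have hij' : i ≤ j := lt_of_pos (s' := s) hs' (by omega)
  have hij : i < j := by
    rcases Nat.lt_or_eq_of_le hij' with h | h
    · exact h
    · subst h
      have := hdeg i
      omega
  have Hi := hdeg i
  have Hj := hdeg j
  have hp2 : stepSum ((W d (deg T b) (deg T a) N).take (d * i + s + 2)) =
      bal (deg T b) (deg T a) (i + 1) - ((d - s - 2 : ℕ) : ℤ) := by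
    rw [add_assoc, W_height hdeg hi (by omega), bal_succ]
    omega
  have hq : stepSum ((W d (deg T b) (deg T a) N).take (d * j + s')) =
      bal (deg T b) (deg T a) j - s' := by
    rw [W_height hdeg hj (by omega)]
    omega
  rw [hp2] at h3 h4
  rw [hq] at h3
  -- arcs from i ending before j
  have hα : (T.filter fun t => a t = i ∧ b t < j).card ≤ d - s - 2 := by
    by_contra hc
    push Not at hc
    obtain ⟨t0, ht0, hmax⟩ := Finset.exists_max_image (T.filter fun t => a t = i ∧ b t < j) b
      (Finset.card_pos.mp (by omega))
    simp only [Finset.mem_filter] at ht0 hmax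
    obtain ⟨ht0, ha0, hb0⟩ := ht0
    have hlt := h.1 t0 ht0
    have He := hdeg (b t0)
    have := h4 (d * b t0 + deg T b (b t0)) (by rw [add_assoc]; exact pos_lt (by omega) (by omega))
      (pos_lt (by omega) (by omega))
    rw [W_height hdeg (by omega) (by omega)] at this
    have key : bal (deg T b) (deg T a) (b t0) - deg T b (b t0) - bal (deg T b) (deg T a) (i+1) ≤
        - ((T.filter fun t => a t = i ∧ b t < j).card : ℤ) := by
      rw [bal_sum, bal_sum, deg_sum, card_sum, ← Finset.sum_sub_distrib, ← Finset.sum_sub_distrib,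
        ← Finset.sum_neg_distrib]
      refine Finset.sum_le_sum fun t ht => ?_
      have h1 := h.1 t ht
      have h2 := h.2 t0 ht0 t ht
      have h3 := hmax t
      split_ifs <;> grind
    omega
  have hβ : (T.filter fun t => b t = j ∧ i < a t).card ≤ s' := by
    by_contra hc
    push Not at hc
    obtain ⟨t0, ht0, hmin⟩ := Finset.exists_min_image (T.filter fun t => b t = j ∧ i < a t) a
      (Finset.card_pos.mp (by omega))
    simp only [Finset.mem_filter] at ht0 hmin
    obtain ⟨ht0, hb0, ha0⟩ := ht0
    have hlt := h.1 t0 ht0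
    have He := hdeg (a t0)
    have := h4 (d * a t0 + (d - deg T a (a t0)))
      (by rw [add_assoc]; exact pos_lt (by omega) (by omega))
      (pos_lt (by omega) (by omega))
    rw [W_height hdeg (by omega) (by omega)] at this
    have key : bal (deg T b) (deg T a) (a t0) - deg T b (a t0) - bal (deg T b) (deg T a) j ≤
        - ((T.filter fun t => b t = j ∧ i < a t).card : ℤ) := by
      rw [bal_sum, bal_sum, deg_sum, card_sum, ← Finset.sum_sub_distrib, ← Finset.sum_sub_distrib,
        ← Finset.sum_neg_distrib]
      refine Finset.sum_le_sum fun t ht => ?_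
      have h1 := h.1 t ht
      have h2 := h.2 t ht t0 ht0
      have h3 := hmin t
      split_ifs <;> grind
    omega
  have hone : (T.filter fun t => a t = i ∧ b t = j).card ≤ 1 := by
    rw [Finset.card_le_one]
    intro x hx y hy
    simp only [Finset.mem_filter] at hx hy
    exact inj x hx.1 y hy.1 (by omega) (by omega)
  have e1 : ∃ t ∈ T, a t = i ∧ j < b t := by
    by_contra hc
    push Not at hc
    have : deg T a i ≤ (T.filter fun t => a t = i ∧ b t < j).card +
        (T.filter fun t => a t = i ∧ b t = j).card := by
      rw [deg]
      refine le_trans (Finset.card_le_card ?_) (Finset.card_union_le _ _)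
      intro t ht
      simp only [Finset.mem_filter, Finset.mem_union] at ht ⊢
      have := hc t ht.1 ht.2
      grind
    omega
  have e2 : ∃ t ∈ T, b t = j ∧ a t < i := by
    by_contra hc
    push Not at hc
    have : deg T b j ≤ (T.filter fun t => b t = j ∧ i < a t).card +
        (T.filter fun t => a t = i ∧ b t = j).card := by
      rw [deg]
      refine le_trans (Finset.card_le_card ?_) (Finset.card_union_le _ _)
      intro t ht
      simp only [Finset.mem_filter, Finset.mem_union] at ht ⊢
      have := hc t ht.1 ht.2
      grind
    omega
  obtain ⟨t, ht, h5, h6⟩ := e1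
  obtain ⟨u, hu, h7, h8⟩ := e2
  exact h.2 u hu t ht (by omega)

theorem dup_lambda {ι : Type} {T : Finset ι} {a b : ι → ℕ} {d N : ℕ} (hd : 1 ≤ d) (h : NC T a b)
    (hdeg : ∀ i, deg T b i + deg T a i ≤ d) (hN : ∀ t ∈ T, b t < N) {t1 t2 : ι}
    (ht1 : t1 ∈ T) (ht2 : t2 ∈ T) (hne : t1 ≠ t2) (ha : a t1 = a t2) (hb : b t1 = b t2) :
    HasLambda d (W d (deg T b) (deg T a) N) := by
  classical
  rw [hasLambda_iff]
  obtain ⟨i, hi⟩ : ∃ i, i = a t1 := ⟨_, rfl⟩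
  obtain ⟨j, hj⟩ : ∃ j, j = b t1 := ⟨_, rfl⟩
  obtain ⟨α, hα⟩ : ∃ α, α = (T.filter fun t => a t = i ∧ b t < j).card := ⟨_, rfl⟩
  obtain ⟨β, hβ⟩ : ∃ β, β = (T.filter fun t => b t = j ∧ i < a t).card := ⟨_, rfl⟩
  have hij : i < j := by have := h.1 t1 ht1; omega
  have hjN : j < N := by have := hN t1 ht1; omega
  have htwo : 2 ≤ (T.filter fun t => a t = i ∧ b t = j).card := by
    have : 1 < (T.filter fun t => a t = i ∧ b t = j).card := by
      rw [Finset.one_lt_card]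
      refine ⟨t1, ?_, t2, ?_, hne⟩ <;> simp [*]
    omega
  have hri : α + 2 ≤ deg T a i := by
    have : α + (T.filter fun t => a t = i ∧ b t = j).card ≤ deg T a i := by
      rw [hα, deg, ← Finset.card_union_of_disjoint]
      · refine Finset.card_le_card fun t ht => ?_
        simp only [Finset.mem_filter, Finset.mem_union] at ht ⊢
        grind
      · rw [Finset.disjoint_left]
        intro t ht
        simp only [Finset.mem_filter] at ht ⊢
        grind
    omega
  have hlj : β + 2 ≤ deg T b j := by
    have : β + (T.filter fun t => a t = i ∧ b t = j).card ≤ deg T b j := by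
      rw [hβ, deg, ← Finset.card_union_of_disjoint]
      · refine Finset.card_le_card fun t ht => ?_
        simp only [Finset.mem_filter, Finset.mem_union] at ht ⊢
        grind
      · rw [Finset.disjoint_left]
        intro t ht
        simp only [Finset.mem_filter] at ht ⊢
        grind
    omega
  have Hi := hdeg i
  have Hj := hdeg j
  have hp2 : stepSum ((W d (deg T b) (deg T a) N).take (d * i + (d - α - 2) + 2)) =
      bal (deg T b) (deg T a) (i + 1) - α := by
    rw [add_assoc, W_height hdeg (by omega) (by omega), bal_succ]
    omega
  refine ⟨d * i + (d - α - 2), d * j + β, ?_, ?_, ?_, ?_, ?_, mod_ne' (by omega),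
    mod_ne' (by omega), ?_, ?_⟩
  · rw [add_assoc]; exact pos_lt (by omega) hij
  · rw [getU hdeg (by omega) (by omega)]; omega
  · rw [add_assoc, getU hdeg (by omega) (by omega)]; omega
  · rw [getD hdeg (by omega) (by omega)]; omega
  · rw [add_assoc, getD hdeg (by omega) (by omega)]; omega
  · rw [hp2, W_height hdeg hjN (by omega)]
    have key : bal (deg T b) (deg T a) j - β = bal (deg T b) (deg T a) (i + 1) - α := by
      rw [hα, hβ, bal_sum, bal_sum, card_sum, card_sum, ← Finset.sum_sub_distrib,
        ← Finset.sum_sub_distrib]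
      refine Finset.sum_congr rfl fun t ht => ?_
      have h1 := h.1 t ht
      have h2 := h.2 t ht t1 ht1
      have h3 := h.2 t1 ht1 t ht
      split_ifs <;> grind
    omega
  · intro k hk1 hk2
    rw [hp2]
    obtain ⟨v, s, hs, rfl⟩ := dm hd k
    have hvj : v ≤ j := by
      by_contra hc
      have := pos_lt (d := d) (s := β + 1) (s' := s) (by omega) (show j < v by omega)
      omega
    have hiv : i ≤ v := lt_of_pos (s' := d - α - 2) hs (by omega)
    have Hv := hdeg v
    rw [W_height hdeg (by omega) (by omega)]
    rcases Nat.lt_or_eq_of_le hiv with hiv | rfl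
    · rcases Nat.lt_or_eq_of_le hvj with hvj | rfl
      · have key : bal (deg T b) (deg T a) (i + 1) - α ≤
            bal (deg T b) (deg T a) v - deg T b v := by
          rw [hα, bal_sum, bal_sum, card_sum, deg_sum, ← Finset.sum_sub_distrib,
            ← Finset.sum_sub_distrib]
          refine Finset.sum_le_sum fun t ht => ?_
          have h1 := h.1 t ht
          have h2 := h.2 t ht t1 ht1
          have h3 := h.2 t1 ht1 t ht
          split_ifs <;> grind
        omega
      · have key : bal (deg T b) (deg T a) (i + 1) - α ≤ bal (deg T b) (deg T a) v - β := by
          rw [hα, hβ, bal_sum, bal_sum, card_sum, card_sum, ← Finset.sum_sub_distrib,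
            ← Finset.sum_sub_distrib]
          refine Finset.sum_le_sum fun t ht => ?_
          have h1 := h.1 t ht
          have h2 := h.2 t ht t1 ht1
          have h3 := h.2 t1 ht1 t ht
          split_ifs <;> grind
        omega
    · rw [bal_succ]
      omega

theorem deg_pos {ι : Type} {T : Finset ι} {a : ι → ℕ} {v : ℕ} :
    0 < deg T a v ↔ ∃ t ∈ T, a t = v := by
  simp [deg, Finset.card_pos, Finset.Nonempty]

theorem short_arc {ι : Type} {T : Finset ι} {a b : ι → ℕ} {m d N : ℕ} (hd : 1 ≤ d)
    (h : NC T a b) (hdeg : ∀ i, deg T b i + deg T a i ≤ d)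
    (hs : HasShortUD m d (W d (deg T b) (deg T a) N)) : ∃ t ∈ T, b t < a t + m := by
  rw [hasShort_iff] at hs
  obtain ⟨k, p, hk, hu, hl, hD⟩ := hs
  obtain ⟨i, s, hs, rfl⟩ := dm hd p
  have hi := idx_lt hdeg hu
  rw [getU hdeg hi hs] at hu
  have Hi := hdeg i
  have hsd : s + 1 = d := by
    by_contra hc
    have hs1 : s + 1 < d := by omega
    rcases Nat.eq_zero_or_pos (k * d) with h0 | h0
    · rw [h0, Nat.add_zero, add_assoc, getD hdeg hi hs1] at hD
      omega
    · have := hl 0 h0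
      rw [Nat.add_zero, add_assoc, getL hdeg hi hs1] at this
      omega
  have hD' : (W d (deg T b) (deg T a) N)[d * (i + 1 + k) + 0]? = some DStep.D := by
    rw [← hD]; congr 1; rw [add_assoc (d * i), hsd]; ring
  have hj := idx_lt hdeg hD'
  rw [getD hdeg hj (by omega)] at hD'
  have hz : ∀ v, i < v → v < i + 1 + k → deg T b v = 0 ∧ deg T a v = 0 := by
    intro v h1 h2
    obtain ⟨e, rfl⟩ := Nat.exists_eq_add_of_le (show i + 1 ≤ v by omega)
    have hek : d * (e + 1) ≤ d * k := Nat.mul_le_mul_left _ (by omega)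
    rw [Nat.mul_add, mul_comm d k] at hek
    have hL : ∀ x < d, (W d (deg T b) (deg T a) N)[d * (i + 1 + e) + x]? = some DStep.L := by
      intro x hx
      rw [← hl (d * e + x) (by omega)]
      congr 1; rw [add_assoc (d * i) s, hsd]; ring
    have l1 := hL 0 (by omega)
    have l2 := hL (d - 1) (by omega)
    rw [getL hdeg (by omega) (by omega)] at l1 l2
    omega
  obtain ⟨t, ht, hta⟩ := deg_pos.mp (show 0 < deg T a i by omega)
  obtain ⟨u, hu', hub⟩ := deg_pos.mp hD'
  have n1 : i + 1 + k ≤ b t := by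
    by_contra hc
    have := h.1 t ht
    have := (hz (b t) (by omega) (by omega)).1
    have := deg_pos.mpr ⟨t, ht, (rfl : b t = b t)⟩
    omega
  have n2 : a u ≤ i := by
    by_contra hc
    have := h.1 u hu'
    have := (hz (a u) (by omega) (by omega)).2
    have := deg_pos.mpr ⟨u, hu', (rfl : a u = a u)⟩
    omega
  have := h.2 u hu' t ht
  by_cases hh : a u = i
  · exact ⟨u, hu', by omega⟩
  · exact ⟨t, ht, by omega⟩

theorem arc_short {ι : Type} {T : Finset ι} {a b : ι → ℕ} {m d N : ℕ} (hd : 1 ≤ d)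
    (h : NC T a b) (hdeg : ∀ i, deg T b i + deg T a i ≤ d) (hN : ∀ t ∈ T, b t < N)
    (hs : ∃ t ∈ T, b t < a t + m) : HasShortUD m d (W d (deg T b) (deg T a) N) := by
  obtain ⟨t0, ht0, hm0⟩ := hs
  obtain ⟨t, ht, hmin⟩ := Finset.exists_min_image T (fun t => b t - a t) ⟨t0, ht0⟩
  have hlt := h.1 t ht
  have hm : b t < a t + m := by
    have := hmin t0 ht0
    have := h.1 t0 ht0
    omega
  have hbN := hN t ht
  rw [hasShort_iff]
  have hra := deg_pos.mpr ⟨t, ht, (rfl : a t = a t)⟩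
  have hrb := deg_pos.mpr ⟨t, ht, (rfl : b t = b t)⟩
  have Ha := hdeg (a t)
  obtain ⟨k, hk⟩ : ∃ k, b t = a t + 1 + k := Nat.exists_eq_add_of_le hlt
  refine ⟨k, d * a t + (d - 1), by omega, ?_, ?_, ?_⟩
  · rw [getU hdeg (by omega) (by omega)]; omega
  · intro x hx
    obtain ⟨e, s, hs, rfl⟩ := dm hd x
    have hek : e < k := by
      by_contra hc
      have : d * k ≤ d * e := Nat.mul_le_mul_left _ (by omega)
      rw [mul_comm d k] at this
      omega
    have hz : deg T b (a t + 1 + e) = 0 ∧ deg T a (a t + 1 + e) = 0 := by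
      constructor
      · by_contra hc
        obtain ⟨u, hu, hub⟩ := deg_pos.mp (Nat.pos_of_ne_zero hc)
        have h1 := h.2 u hu t ht
        have h2 := hmin u hu
        have h3 := h.1 u hu
        omega
      · by_contra hc
        obtain ⟨u, hu, hub⟩ := deg_pos.mp (Nat.pos_of_ne_zero hc)
        have h1 := h.2 t ht u hu
        have h2 := hmin u hu
        have h3 := h.1 u hu
        omega
    have : d * a t + (d - 1) + 1 + (d * e + s) = d * (a t + 1 + e) + s := by
      rw [add_assoc (d * a t), Nat.sub_add_cancel hd]; ring
    rw [this, getL hdeg (by omega) hs]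
    omega
  · have : d * a t + (d - 1) + 1 + k * d = d * (b t) + 0 := by
      rw [add_assoc (d * a t), Nat.sub_add_cancel hd, hk]; ring
    rw [this, getD hdeg (by omega) (by omega)]
    exact hrb

end Stk
namespace Stk

/-- The common innermost arc. -/
theorem inner_mem {S : Finset (ℕ × ℕ)} (h : NC S Prod.fst Prod.snd) {i j : ℕ} (hij : i < j)
    (hj : 0 < deg S Prod.snd j) (hi : 0 < deg S Prod.fst i)
    (hj' : ∀ v < j, deg S Prod.snd v = 0) (hi' : ∀ v, i < v → v < j → deg S Prod.fst v = 0) :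
    (i, j) ∈ S := by
  obtain ⟨p, hp, hpj⟩ := deg_pos.mp hj
  obtain ⟨q, hq, hqi⟩ := deg_pos.mp hi
  have n1 : j ≤ q.2 := by
    by_contra hc
    have := hj' q.2 (by omega)
    have := deg_pos.mpr ⟨q, hq, (rfl : Prod.snd q = Prod.snd q)⟩
    omega
  have n2 : p.1 ≤ i := by
    by_contra hc
    have := h.1 p hp
    have := hi' p.1 (by omega) (by omega)
    have := deg_pos.mpr ⟨p, hp, (rfl : Prod.fst p = Prod.fst p)⟩
    omega
  have := h.2 p hp q hq
  by_cases hh : p.1 = i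
  · have : (i, j) = p := by ext <;> simp [hh, hpj]
    rw [this]; exact hp
  · have : (i, j) = q := by
      ext
      · simp [hqi]
      · simp; omega
    rw [this]; exact hq

theorem deg_erase {ι : Type} [DecidableEq ι] {S : Finset ι} (a : ι → ℕ) {p : ι} (hp : p ∈ S)
    (v : ℕ) : deg (S.erase p) a v = deg S a v - if a p = v then 1 else 0 := by
  unfold deg
  rw [Finset.filter_erase]
  split_ifs with hh
  · rw [Finset.card_erase_of_mem (by simp [hp, hh])]
  · rw [Finset.erase_eq_of_notMem (by simp [hh])]; rfl

theorem NC.mono {ι : Type} {S T : Finset ι} {a b : ι → ℕ} (h : NC T a b) (hs : S ⊆ T) :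
    NC S a b :=
  ⟨fun t ht => h.1 t (hs ht), fun t ht u hu => h.2 t (hs ht) u (hs hu)⟩

/-- Existence of innermost position. -/
theorem exists_inner {l r : ℕ → ℕ} (hb : ∀ v, (l v : ℤ) ≤ bal l r v) {x : ℕ} (hx : 0 < l x) :
    ∃ i j, i < j ∧ 0 < l j ∧ 0 < r i ∧ (∀ v < j, l v = 0) ∧ (∀ v, i < v → v < j → r v = 0) := by
  classical
  have hex : ∃ j, 0 < l j := ⟨x, hx⟩
  have hj := Nat.find_spec hex
  have hj' : ∀ v < Nat.find hex, l v = 0 := fun v hv => by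
    have := Nat.find_min hex hv
    omega
  generalize Nat.find hex = j at hj hj'
  have h1 := hb j
  have hne : ((Finset.range j).filter fun u => 0 < r u).Nonempty := by
    by_contra hc
    rw [Finset.not_nonempty_iff_eq_empty, Finset.filter_eq_empty_iff] at hc
    have : bal l r j ≤ 0 := by
      unfold bal
      refine Finset.sum_nonpos fun u hu => ?_
      have := hc hu
      omega
    omega
  obtain ⟨i, hi, hmax⟩ := Finset.exists_max_image _ id hne
  simp only [Finset.mem_filter, Finset.mem_range, id] at hi hmax
  refine ⟨i, j, hi.1, hj, hi.2, hj', fun v h2 h3 => ?_⟩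
  by_contra hc
  have := hmax v ⟨h3, Nat.pos_of_ne_zero hc⟩
  omega

theorem inj_aux (k : ℕ) : ∀ S S' : Finset (ℕ × ℕ), S.card = k → NC S Prod.fst Prod.snd →
    NC S' Prod.fst Prod.snd → (∀ v, deg S Prod.snd v = deg S' Prod.snd v) →
    (∀ v, deg S Prod.fst v = deg S' Prod.fst v) → S = S' := by
  induction k with
  | zero =>
    intro S S' hk _ _ h1 _
    rw [Finset.card_eq_zero] at hk
    subst hk
    symm
    rw [Finset.eq_empty_iff_forall_notMem]
    intro p hp
    have := deg_pos.mpr ⟨p, hp, (rfl : Prod.snd p = Prod.snd p)⟩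
    rw [← h1] at this
    simp [deg] at this
  | succ k ih =>
    intro S S' hk hS hS' h1 h2
    obtain ⟨p, hp⟩ := Finset.card_pos.mp (show 0 < S.card by omega)
    obtain ⟨i, j, hij, hj, hi, hj', hi'⟩ := exists_inner (ballot hS)
      (deg_pos.mpr ⟨p, hp, (rfl : Prod.snd p = Prod.snd p)⟩)
    have m1 := inner_mem hS hij hj hi hj' hi'
    have m2 : (i, j) ∈ S' := by
      refine inner_mem hS' hij ?_ ?_ ?_ ?_
      · rw [← h1]; exact hj
      · rw [← h2]; exact hi
      · intro v hv; rw [← h1]; exact hj' v hv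
      · intro v hv hv'; rw [← h2]; exact hi' v hv hv'
    have := ih (S.erase (i, j)) (S'.erase (i, j)) (by rw [Finset.card_erase_of_mem m1]; omega)
      (hS.mono (Finset.erase_subset _ _)) (hS'.mono (Finset.erase_subset _ _))
      (fun v => by rw [deg_erase _ m1, deg_erase _ m2, h1])
      (fun v => by rw [deg_erase _ m1, deg_erase _ m2, h2])
    rw [← Finset.insert_erase m1, ← Finset.insert_erase m2, this]

theorem deg_range_succ (k : ℕ) (a : ℕ → ℕ) (x v : ℕ) :
    deg (Finset.range (k + 1)) (Function.update a k x) v =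
      deg (Finset.range k) a v + if x = v then 1 else 0 := by
  have : (deg (Finset.range (k + 1)) (Function.update a k x) v : ℤ) =
      deg (Finset.range k) a v + if x = v then 1 else 0 := by
    rw [deg_sum, deg_sum, Finset.sum_range_succ]
    congr 1
    · refine Finset.sum_congr rfl fun t ht => ?_
      rw [Finset.mem_range] at ht
      rw [Function.update_of_ne (by omega)]
    · rw [Function.update_self]
  split_ifs at * <;> omega

theorem exists_family (N k : ℕ) : ∀ l r : ℕ → ℕ, (∀ v, (l v : ℤ) ≤ bal l r v) →
    (∀ v, N ≤ v → l v = 0) → (∀ v, N ≤ v → r v = 0) → bal l r N = 0 →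
    ∑ v ∈ Finset.range N, l v = k →
    ∃ a b : ℕ → ℕ, NC (Finset.range k) a b ∧ deg (Finset.range k) b = l ∧
      deg (Finset.range k) a = r := by
  induction k with
  | zero =>
    intro l r hb hl hr h0 hs
    have hl0 : ∀ v, l v = 0 := by
      intro v
      by_cases hv : v < N
      · exact Finset.sum_eq_zero_iff.mp hs v (by simpa using hv)
      · exact hl v (by omega)
    have hr0 : ∀ v, r v = 0 := by
      intro v
      by_cases hv : v < N
      · unfold bal at h0
        simp only [hl0, Nat.cast_zero, sub_zero] at h0
        have h0' : ∑ v ∈ Finset.range N, r v = 0 := by exact_mod_cast h0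
        exact Finset.sum_eq_zero_iff.mp h0' v (by simpa using hv)
      · exact hr v (by omega)
    refine ⟨fun _ => 0, fun _ => 0, ?_, ?_, ?_⟩
    · simp [NC]
    · funext v; simp [deg, hl0]
    · funext v; simp [deg, hr0]
  | succ k ih =>
    intro l r hb hl hr h0 hs
    obtain ⟨x, hx⟩ : ∃ x, 0 < l x := by
      by_contra hc
      push Not at hc
      have : ∑ v ∈ Finset.range N, l v = 0 := Finset.sum_eq_zero fun v _ => by
        have := hc v; omega
      omega
    obtain ⟨i, j, hij, hj, hi, hj', hi'⟩ := exists_inner hb hx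
    have hjN : j < N := by
      by_contra hc
      have := hl j (by omega)
      omega
    obtain ⟨l', hl'⟩ : ∃ l' : ℕ → ℕ, ∀ v, l v = l' v + if j = v then 1 else 0 :=
      ⟨fun v => l v - if j = v then 1 else 0, fun v => by
        simp only; split_ifs with hh
        · subst hh; omega
        · omega⟩
    obtain ⟨r', hr'⟩ : ∃ r' : ℕ → ℕ, ∀ v, r v = r' v + if i = v then 1 else 0 :=
      ⟨fun v => r v - if i = v then 1 else 0, fun v => by
        simp only; split_ifs with hh
        · subst hh; omega
        · omega⟩
    have hbal : ∀ v, bal l r v = bal l' r' v + ((if i < v then 1 else 0) - if j < v then 1 else 0) := by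
      intro v
      induction v with
      | zero => simp [bal]
      | succ v ihv =>
        rw [bal_succ, bal_succ, ihv, hl' v, hr' v]
        push_cast
        split_ifs <;> omega
    have hb' : ∀ v, (l' v : ℤ) ≤ bal l' r' v := by
      intro v
      have e1 := hb v
      have e2 := hl' v
      have e3 := hbal v
      by_cases c1 : v ≤ i
      · split_ifs at * <;> omega
      · by_cases c2 : j ≤ v
        · split_ifs at * <;> omega
        · -- between
          have z1 : l' v = 0 := by have := hj' v (by omega); omega
          rw [z1]
          unfold bal
          refine Finset.sum_nonneg fun u hu => ?_
          rw [Finset.mem_range] at hu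
          have := hj' u (by omega)
          have := hl' u
          omega
    have hsum : ∑ v ∈ Finset.range N, l' v = k := by
      have : ∑ v ∈ Finset.range N, l v = ∑ v ∈ Finset.range N, l' v + 1 := by
        simp only [hl', Finset.sum_add_distrib]
        simp [hjN]
      omega
    obtain ⟨a, b, hNC, hdb, hda⟩ := ih l' r' hb'
      (fun v hv => by have := hl v hv; have := hl' v; omega)
      (fun v hv => by have := hr v hv; have := hr' v; omega)
      (by have := hbal N; rw [h0, if_pos (by omega), if_pos hjN] at this; omega) hsum
    have hbj : ∀ t < k, j ≤ b t := by
      intro t ht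
      by_contra hc
      have e1 := deg_pos.mpr ⟨t, Finset.mem_range.mpr ht, (rfl : b t = b t)⟩
      rw [hdb] at e1
      have := hl' (b t)
      have := hj' (b t) (by omega)
      omega
    have hai : ∀ t < k, a t ≤ i ∨ j ≤ a t := by
      intro t ht
      by_contra hc
      have e1 := deg_pos.mpr ⟨t, Finset.mem_range.mpr ht, (rfl : a t = a t)⟩
      rw [hda] at e1
      have := hr' (a t)
      have := hi' (a t) (by omega) (by omega)
      omega
    refine ⟨Function.update a k i, Function.update b k j, ⟨?_, ?_⟩, ?_, ?_⟩
    · intro t ht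
      rw [Finset.mem_range] at ht
      by_cases hk : t = k
      · subst hk; simpa using hij
      · simp only [Function.update_of_ne hk]
        exact hNC.1 t (Finset.mem_range.mpr (by omega))
    · intro t ht u hu
      rw [Finset.mem_range] at ht hu
      by_cases hk : t = k
      · subst hk
        by_cases hk' : u = t
        · subst hk'; simp
        · simp only [Function.update_of_ne hk', Function.update_self]
          have := hai u (by omega)
          omega
      · by_cases hk' : u = k
        · subst hk'
          simp only [Function.update_of_ne hk, Function.update_self]
          have := hbj t (by omega)
          omega
        · simp only [Function.update_of_ne hk, Function.update_of_ne hk']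
          exact hNC.2 t (Finset.mem_range.mpr (by omega)) u (Finset.mem_range.mpr (by omega))
    · funext v
      rw [deg_range_succ, hdb, hl']
    · funext v
      rw [deg_range_succ, hda, hr']

end Stk
namespace Stk

theorem W_cons (d : ℕ) (l r : ℕ → ℕ) (N : ℕ) :
    W d l r (N + 1) = piece d (l 0) (r 0) ++ W d (fun i => l (i + 1)) (fun i => r (i + 1)) N := by
  simp [W, List.range_succ_eq_map, List.flatMap_map]

theorem hat_W (d n : ℕ) (l r : ℕ → ℕ) (hl0 : l 0 = 0) (hr0 : r 0 = 0) (hl : l (n + 1) = 0)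
    (hr : r (n + 1) = 0) :
    hatPath d 0 0 (W d (fun i => l (i + 1)) (fun i => r (i + 1)) n) = W d l r (n + 2) := by
  rw [W_cons, W_succ, hl0, hr0, hl, hr]
  simp [hatPath, piece]

theorem bal_shift (l r : ℕ → ℕ) (hl0 : l 0 = 0) (hr0 : r 0 = 0) (i : ℕ) :
    bal (fun i => l (i + 1)) (fun i => r (i + 1)) i = bal l r (i + 1) := by
  simp [bal, Finset.sum_range_succ', hl0, hr0]

theorem isDLU_W {d n : ℕ} (hd : 1 ≤ d) {l r : ℕ → ℕ} (h : ∀ i, l i + r i ≤ d)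
    (hb : ∀ v, (l v : ℤ) ≤ bal l r v) (h0 : bal l r n = 0) :
    IsDLUPath d n 0 0 (W d l r n) := by
  refine ⟨W_length h n, ?_, ?_, ?_⟩
  · intro i hi
    rw [W_block h hi]
    exact ⟨l i, d - l i - r i, r i, by have := h i; omega, rfl⟩
  · rw [W_sum h, h0]; rfl
  · intro k hk
    rw [W_length h] at hk
    obtain ⟨i, s, hs, rfl⟩ := dm hd k
    rcases Nat.lt_or_ge i n with hi | hi
    · rw [W_height h hi hs.le]
      have := hb i
      have := h i
      push_cast
      omega
    · have : d * n ≤ d * i := Nat.mul_le_mul_left _ hi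
      rw [List.take_of_length_le (by rw [W_length h]; omega), W_sum h, h0]
      simp

theorem eq_W {d : ℕ} {l r : ℕ → ℕ} (n : ℕ) : ∀ M : List DStep, M.length = d * n →
    (∀ i < n, (M.drop (d * i)).take d = piece d (l i) (r i)) → M = W d l r n := by
  induction n with
  | zero =>
    intro M hM _
    rw [Nat.mul_zero, List.length_eq_zero_iff] at hM
    simp [hM, W]
  | succ n ih =>
    intro M hM hi
    have hlen : d * (n + 1) = d * n + d := by ring
    rw [W_succ, ← hi n (by omega), ← ih (M.take (d * n))]
    · rw [List.take_of_length_le (l := M.drop (d * n)) (by simp; omega), List.take_append_drop]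
    · simp; omega
    · intro i hin
      rw [← hi i (by omega), List.drop_take, List.take_take, min_eq_left]
      have := pos_lt (d := d) (s := d) (s' := 0) le_rfl hin
      omega

theorem DLU_exists {d n : ℕ} {M : List DStep} (h : IsDLUPath d n 0 0 M) :
    ∃ l r : ℕ → ℕ, (∀ i, l i + r i ≤ d) ∧ l 0 = 0 ∧ r 0 = 0 ∧ (∀ v, n + 1 ≤ v → l v = 0) ∧
      (∀ v, n + 1 ≤ v → r v = 0) ∧ (∀ v, (l v : ℤ) ≤ bal l r v) ∧ bal l r (n + 1) = 0 ∧
      M = W d (fun i => l (i + 1)) (fun i => r (i + 1)) n := by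
  obtain ⟨hlen, hp, hsum, hpos⟩ := h
  choose! A B C hABC hpc using hp
  refine ⟨fun v => if 1 ≤ v ∧ v ≤ n then A (v - 1) else 0,
    fun v => if 1 ≤ v ∧ v ≤ n then C (v - 1) else 0, ?_⟩
  set l : ℕ → ℕ := fun v => if 1 ≤ v ∧ v ≤ n then A (v - 1) else 0 with hl
  set r : ℕ → ℕ := fun v => if 1 ≤ v ∧ v ≤ n then C (v - 1) else 0 with hr
  have hdeg : ∀ i, l i + r i ≤ d := by
    intro i
    simp only [hl, hr]
    split_ifs with hh
    · have := hABC (i - 1) (by omega); omega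
    · omega
  have l0 : l 0 = 0 := by simp [hl]
  have r0 : r 0 = 0 := by simp [hr]
  have lz : ∀ v, n + 1 ≤ v → l v = 0 := by
    intro v hv; simp only [hl]; rw [if_neg (by omega)]
  have rz : ∀ v, n + 1 ≤ v → r v = 0 := by
    intro v hv; simp only [hr]; rw [if_neg (by omega)]
  have hM : M = W d (fun i => l (i + 1)) (fun i => r (i + 1)) n := by
    refine eq_W n M hlen fun i hi => ?_
    rw [hpc i hi]
    simp only [hl, hr]
    rw [if_pos (by omega), if_pos (by omega)]
    have := hABC i hi
    simp only [Nat.add_sub_cancel, piece]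
    rw [show d - A i - C i = B i by omega]
  have hdeg' : ∀ i, (fun i => l (i + 1)) i + (fun i => r (i + 1)) i ≤ d := fun i => hdeg (i + 1)
  have b0 : bal l r (n + 1) = 0 := by
    rw [hM, W_sum hdeg', bal_shift l r l0 r0] at hsum
    simpa using hsum
  have bz : ∀ e, bal l r (n + 1 + e) = 0 := by
    intro e
    induction e with
    | zero => exact b0
    | succ e ih => rw [← add_assoc, bal_succ, ih, lz _ (by omega), rz _ (by omega)]; simp
  refine ⟨hdeg, l0, r0, lz, rz, ?_, b0, hM⟩
  intro v
  rcases Nat.eq_zero_or_pos v with rfl | hv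
  · simp [l0, bal]
  rcases Nat.lt_or_ge v (n + 1) with hv' | hv'
  · obtain ⟨i, rfl⟩ : ∃ i, v = i + 1 := ⟨v - 1, by omega⟩
    have H := hdeg (i + 1)
    have hle : d * i + d ≤ d * n := by
      have := pos_lt (d := d) (s := d) (s' := 0) le_rfl (show i < n by omega)
      omega
    have := hpos (d * i + l (i + 1)) (by rw [hlen]; omega)
    rw [hM, W_height hdeg' (by omega) (by omega), bal_shift l r l0 r0] at this
    push_cast at this
    omega
  · obtain ⟨e, rfl⟩ := Nat.exists_eq_add_of_le hv'
    rw [bz, lz _ hv']; simp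

theorem stack_NC {m d n : ℕ} {S : Finset (ℕ × ℕ)} (h : IsStack m d n S) :
    NC S Prod.fst Prod.snd :=
  ⟨fun p hp => (h.1.1 p hp).2.1, h.1.2.1⟩

theorem deg_eq_zero {ι : Type} {T : Finset ι} {a : ι → ℕ} {v : ℕ} (h : ∀ t ∈ T, a t ≠ v) :
    deg T a v = 0 := by
  by_contra hc
  obtain ⟨t, ht, e⟩ := deg_pos.mp (Nat.pos_of_ne_zero hc)
  exact h t ht e

theorem card_contact {S : Finset (ℕ × ℕ)} (h : ∀ p ∈ S, p.1 < p.2) (v : ℕ) :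
    (S.filter fun p => p.1 = v ∨ p.2 = v).card = deg S Prod.snd v + deg S Prod.fst v := by
  rw [Finset.filter_or, Finset.card_union_of_disjoint, add_comm]; rfl
  rw [Finset.disjoint_left]
  intro t ht ht'
  simp only [Finset.mem_filter] at ht ht'
  have := h t ht.1
  omega

theorem stack_deg {m d n : ℕ} {S : Finset (ℕ × ℕ)} (h : IsStack m d n S) (v : ℕ) :
    deg S Prod.snd v + deg S Prod.fst v ≤ d := by
  rw [← card_contact (fun p hp => (h.1.1 p hp).2.1)]
  exact h.1.2.2 v

theorem eta_eq (d n : ℕ) (S : Finset (ℕ × ℕ)) : eta d n S =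
    W d (fun i => deg S Prod.snd (i + 1)) (fun i => deg S Prod.fst (i + 1)) n := rfl

theorem stack_zero {m d n : ℕ} {S : Finset (ℕ × ℕ)} (h : IsStack m d n S) (v : ℕ)
    (hv : v = 0 ∨ n + 1 ≤ v) : deg S Prod.snd v = 0 ∧ deg S Prod.fst v = 0 := by
  constructor <;>
  · refine deg_eq_zero fun p hp => ?_
    have := h.1.1 p hp
    omega

theorem eta_hat {m d n : ℕ} {S : Finset (ℕ × ℕ)} (h : IsStack m d n S) :
    hatPath d 0 0 (eta d n S) = W d (deg S Prod.snd) (deg S Prod.fst) (n + 2) := by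
  have h1 := stack_zero h 0 (by omega)
  have h2 := stack_zero h (n + 1) (by omega)
  rw [eta_eq, hat_W _ _ _ _ h1.1 h1.2 h2.1 h2.2]

theorem mapsTo {m d n : ℕ} (hd : 1 ≤ d) {S : Finset (ℕ × ℕ)} (h : IsStack m d n S) :
    IsGoodPath m d n 0 0 (eta d n S) := by
  have h1 := stack_zero h 0 (by omega)
  have hNC := stack_NC h
  have hdeg := stack_deg h
  refine ⟨?_, ?_, ?_⟩
  · rw [eta_eq]
    refine isDLU_W hd (fun i => hdeg (i + 1)) ?_ ?_
    · intro v
      rw [bal_shift _ _ h1.1 h1.2]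
      exact ballot hNC (v + 1)
    · rw [bal_shift _ _ h1.1 h1.2, bal_sum]
      refine Finset.sum_eq_zero fun p hp => ?_
      have := h.1.1 p hp
      rw [if_pos (by omega), if_pos (by omega)]; rfl
  · rw [eta_hat h]
    intro hs
    obtain ⟨t, ht, hlt⟩ := short_arc hd hNC hdeg hs
    have := h.2 t ht
    have := hNC.1 t ht
    omega
  · rw [eta_hat h]
    exact no_lambda hd hNC hdeg fun t _ u _ e1 e2 => Prod.ext e1 e2

theorem piece_inj {d a c a' c' : ℕ} (h : piece d a c = piece d a' c') : a = a' ∧ c = c' := by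
  have h1 := congrArg (List.count DStep.D) h
  have h2 := congrArg (List.count DStep.U) h
  simp [piece, List.count_replicate] at h1 h2
  exact ⟨h1, h2⟩

theorem injOn {m d n : ℕ} {S S' : Finset (ℕ × ℕ)} (h : IsStack m d n S) (h' : IsStack m d n S')
    (he : eta d n S = eta d n S') : S = S' := by
  have key : ∀ v, deg S Prod.snd v = deg S' Prod.snd v ∧ deg S Prod.fst v = deg S' Prod.fst v := by
    intro v
    by_cases hv : v = 0 ∨ n + 1 ≤ v
    · have h1 := stack_zero h v hv
      have h2 := stack_zero h' v hv
      omega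
    · obtain ⟨i, rfl⟩ : ∃ i, v = i + 1 := ⟨v - 1, by omega⟩
      rw [eta_eq, eta_eq] at he
      have b1 := W_block (l := fun i => deg S Prod.snd (i + 1))
        (r := fun i => deg S Prod.fst (i + 1)) (fun i => stack_deg h (i + 1))
        (show i < n by omega)
      have b2 := W_block (l := fun i => deg S' Prod.snd (i + 1))
        (r := fun i => deg S' Prod.fst (i + 1)) (fun i => stack_deg h' (i + 1))
        (show i < n by omega)
      rw [he, b2] at b1
      have := piece_inj b1
      exact ⟨this.1.symm, this.2.symm⟩
  exact inj_aux _ S S' rfl (stack_NC h) (stack_NC h') (fun v => (key v).1) (fun v => (key v).2)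

theorem surjOn {m d n : ℕ} (hd : 1 ≤ d) {M : List DStep} (h : IsGoodPath m d n 0 0 M) :
    ∃ S, IsStack m d n S ∧ eta d n S = M := by
  obtain ⟨hDLU, hreg, hlam⟩ := h
  obtain ⟨l, r, hdeg, l0, r0, lz, rz, hb, b0, hM⟩ := DLU_exists hDLU
  obtain ⟨a, b, hNC, hdb, hda⟩ := exists_family (n + 1) _ l r hb lz rz b0 rfl
  generalize Finset.range (∑ v ∈ Finset.range (n + 1), l v) = T at hNC hdb hda
  have hhat : hatPath d 0 0 M = W d (deg T b) (deg T a) (n + 2) := by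
    rw [hM, hdb, hda, hat_W _ _ _ _ l0 r0 (lz _ le_rfl) (rz _ le_rfl)]
  rw [hhat] at hreg hlam
  have hdeg' : ∀ i, deg T b i + deg T a i ≤ d := by rw [hdb, hda]; exact hdeg
  have hbn : ∀ t ∈ T, b t ≤ n := by
    intro t ht
    by_contra hc
    have := deg_pos.mpr ⟨t, ht, (rfl : b t = b t)⟩
    rw [hdb, lz _ (by omega)] at this
    omega
  have ha1 : ∀ t ∈ T, 1 ≤ a t := by
    intro t ht
    by_contra hc
    have := deg_pos.mpr ⟨t, ht, (show a t = 0 by omega)⟩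
    rw [hda, r0] at this
    omega
  have hinj : Set.InjOn (fun t => (a t, b t)) (T : Set ℕ) := by
    intro t ht u hu e
    by_contra hne
    simp only [Prod.mk.injEq] at e
    exact hlam (dup_lambda hd hNC hdeg' (fun t ht => by have := hbn t ht; omega)
      ht hu hne e.1 e.2)
  have hS1 : ∀ v, deg (T.image fun t => (a t, b t)) Prod.snd v = l v := by
    intro v
    rw [← hdb, deg, deg, Finset.filter_image, Finset.card_image_of_injOn]
    exact hinj.mono (Finset.coe_subset.mpr (Finset.filter_subset _ _))
  have hS2 : ∀ v, deg (T.image fun t => (a t, b t)) Prod.fst v = r v := by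
    intro v
    rw [← hda, deg, deg, Finset.filter_image, Finset.card_image_of_injOn]
    exact hinj.mono (Finset.coe_subset.mpr (Finset.filter_subset _ _))
  refine ⟨T.image fun t => (a t, b t), ⟨⟨?_, ?_, ?_⟩, ?_⟩, ?_⟩
  · simp only [Finset.forall_mem_image]
    intro t ht
    exact ⟨ha1 t ht, hNC.1 t ht, hbn t ht⟩
  · simp only [Finset.forall_mem_image]
    exact hNC.2
  · intro v
    rw [card_contact (by simp only [Finset.forall_mem_image]; exact hNC.1), hS1, hS2]
    exact hdeg v
  · unfold ArcsRegular
    simp only [Finset.forall_mem_image]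
    intro t ht
    by_contra hc
    have := hNC.1 t ht
    exact hreg (arc_short hd hNC hdeg' (fun t ht => by have := hbn t ht; omega)
      ⟨t, ht, by omega⟩)
  · rw [eta_eq, hM]
    simp only [hS1, hS2]

end Stk

theorem stmt0 (m d n : ℕ) (hm : 1 ≤ m) (hd : 1 ≤ d) :
    Set.BijOn (eta d n) {S : Finset (ℕ × ℕ) | IsStack m d n S}
      {M : List DStep | IsGoodPath m d n 0 0 M} ∧
    sCount m d n = gCount m d n 0 0 := by
  have hbij : Set.BijOn (eta d n) {S : Finset (ℕ × ℕ) | IsStack m d n S}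
      {M : List DStep | IsGoodPath m d n 0 0 M} :=
    ⟨fun S hS => Stk.mapsTo hd hS, fun S hS S' hS' he => Stk.injOn hS hS' he,
      fun M hM => by
        obtain ⟨S, hS, e⟩ := Stk.surjOn hd hM
        exact ⟨S, hS, e⟩⟩
  refine ⟨hbij, ?_⟩
  unfold sCount gCount
  rw [← hbij.image_eq, Set.ncard_image_of_injOn hbij.injOn]
end

section
/- For all integers m ≥ 1, d ≥ 1, n ≥ 0 and any d-contact stack S on [n] (a noncrossing set of arcs in which every vertex lies in at most d arcs), the word η(S) = P_1 P_2 ⋯ P_n with P_v = D^{ldeg(v)} L^{d − ldeg(v) − rdeg(v)} U^{rdeg(v)} is a DLU path of length dn from (0,0) to (dn,0); in particular it never passes below the x-axis. -/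
/-- The piece of `eta` at vertex `i + 1`. -/
def pieceAt (d : ℕ) (S : Finset (ℕ × ℕ)) (i : ℕ) : List DStep :=
    List.replicate (ldeg S (i + 1)) DStep.D ++
      List.replicate (d - ldeg S (i + 1) - rdeg S (i + 1)) DStep.L ++
      List.replicate (rdeg S (i + 1)) DStep.U

/-- Number of arcs open just after vertex `k`. -/
def openArcs (S : Finset (ℕ × ℕ)) (k : ℕ) : ℕ := (S.filter fun p => p.1 ≤ k ∧ k < p.2).card

/-- Arcs passing strictly over vertex `k + 1`. -/
def overArcs (S : Finset (ℕ × ℕ)) (k : ℕ) : ℕ := (S.filter fun p => p.1 ≤ k ∧ k + 1 < p.2).card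

theorem eta_succ (d k : ℕ) (S : Finset (ℕ × ℕ)) :
    eta d (k + 1) S = eta d k S ++ pieceAt d S k := by
  simp [eta, pieceAt, List.range_succ]

theorem stepSum_append (a b : List DStep) : stepSum (a ++ b) = stepSum a + stepSum b := by
  simp [stepSum]

theorem stepSum_replicate (a : ℕ) (x : DStep) :
    stepSum (List.replicate a x) = a * x.val := by
  simp [stepSum]

theorem stepSum_pieceAt (d k : ℕ) (S : Finset (ℕ × ℕ)) :
    stepSum (pieceAt d S k) = rdeg S (k + 1) - ldeg S (k + 1) := by
  simp only [pieceAt, stepSum_append, stepSum_replicate, DStep.val]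
  ring

theorem stepSum_take_pieceAt (d k j : ℕ) (S : Finset (ℕ × ℕ)) :
    - (ldeg S (k + 1) : ℤ) ≤ stepSum ((pieceAt d S k).take j) := by
  simp only [pieceAt, List.take_append, List.take_replicate, stepSum_append, stepSum_replicate,
    DStep.val]
  omega

theorem open_eq (S : Finset (ℕ × ℕ)) (hlt : ∀ p ∈ S, p.1 < p.2) (k : ℕ) :
    openArcs S k = ldeg S (k + 1) + overArcs S k := by
  unfold openArcs ldeg overArcs
  rw [← Finset.card_union_of_disjoint, ← Finset.filter_or]
  · congr 1
    apply Finset.filter_congr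
    intro p hp
    have := hlt p hp
    omega
  · rw [Finset.disjoint_filter]
    intro p hp
    omega

theorem open_succ_eq (S : Finset (ℕ × ℕ)) (hlt : ∀ p ∈ S, p.1 < p.2) (k : ℕ) :
    openArcs S (k + 1) = rdeg S (k + 1) + overArcs S k := by
  unfold openArcs rdeg overArcs
  rw [← Finset.card_union_of_disjoint, ← Finset.filter_or]
  · congr 1
    apply Finset.filter_congr
    intro p hp
    have := hlt p hp
    omega
  · rw [Finset.disjoint_filter]
    intro p hp
    omega

theorem deg_le (d : ℕ) (S : Finset (ℕ × ℕ)) (hlt : ∀ p ∈ S, p.1 < p.2)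
    (hdeg : ∀ v : ℕ, (S.filter fun p => p.1 = v ∨ p.2 = v).card ≤ d) (v : ℕ) :
    ldeg S v + rdeg S v ≤ d := by
  refine le_trans (le_of_eq ?_) (hdeg v)
  unfold ldeg rdeg
  rw [Finset.filter_or, Finset.card_union_of_disjoint, add_comm]
  rw [Finset.disjoint_filter]
  intro p hp
  have := hlt p hp
  omega

theorem eta_main (d : ℕ) (S : Finset (ℕ × ℕ)) (hlt : ∀ p ∈ S, 1 ≤ p.1 ∧ p.1 < p.2)
    (hdeg : ∀ v : ℕ, (S.filter fun p => p.1 = v ∨ p.2 = v).card ≤ d) (k : ℕ) :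
    (eta d k S).length = d * k ∧
    (∀ i < k, IsPieceWord d (((eta d k S).drop (d * i)).take d)) ∧
    stepSum (eta d k S) = openArcs S k ∧
    ∀ j, 0 ≤ stepSum ((eta d k S).take j) := by
  have hlt' : ∀ p ∈ S, p.1 < p.2 := fun p hp => (hlt p hp).2
  induction k with
  | zero =>
    refine ⟨by simp [eta], by simp, ?_, by simp [eta, stepSum]⟩
    have : openArcs S 0 = 0 := by
      unfold openArcs
      rw [Finset.card_eq_zero, Finset.filter_eq_empty_iff]
      intro p hp
      have := hlt p hp
      omega
    rw [this]
    simp [eta, stepSum]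
  | succ k ih =>
    obtain ⟨h1, h2, h3, h4⟩ := ih
    have hdl := deg_le d S hlt' hdeg (k + 1)
    have hlen : (pieceAt d S k).length = d := by
      simp [pieceAt]
      omega
    have ho := open_eq S hlt' k
    have ho' := open_succ_eq S hlt' k
    rw [eta_succ]
    refine ⟨by rw [List.length_append, h1, hlen]; ring, ?_, ?_, ?_⟩
    · intro i hi
      rcases Nat.lt_succ_iff_lt_or_eq.mp hi with hi | rfl
      · have hle : d * i + d ≤ d * k := by
          calc d * i + d = d * (i + 1) := by ring
            _ ≤ d * k := Nat.mul_le_mul_left d hi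
        rw [List.drop_append_of_le_length (by omega),
          List.take_append_of_le_length (by rw [List.length_drop]; omega)]
        exact h2 i hi
      · rw [← h1, List.drop_left, List.take_of_length_le hlen.le]
        exact ⟨_, _, _, by omega, rfl⟩
    · rw [stepSum_append, h3, stepSum_pieceAt]
      omega
    · intro j
      rw [List.take_append, stepSum_append]
      rcases le_total j (eta d k S).length with hj | hj
      · rw [Nat.sub_eq_zero_of_le hj]
        simpa [stepSum] using h4 j
      · rw [List.take_of_length_le hj, h3]
        have := stepSum_take_pieceAt d k (j - (eta d k S).length) S
        omega

theorem stmt1 (m d n : ℕ) (hm : 1 ≤ m) (hd : 1 ≤ d) (S : Finset (ℕ × ℕ))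
    (hS : IsContactStack d n S) :
    IsDLUPath d n 0 0 (eta d n S) := by
  obtain ⟨hb, -, hdeg⟩ := hS
  obtain ⟨h1, h2, h3, h4⟩ := eta_main d S (fun p hp => ⟨(hb p hp).1, (hb p hp).2.1⟩) hdeg n
  refine ⟨h1, h2, ?_, fun k _ => by simpa using h4 k⟩
  have : openArcs S n = 0 := by
    unfold openArcs
    rw [Finset.card_eq_zero, Finset.filter_eq_empty_iff]
    intro p hp
    have := hb p hp
    omega
  rw [h3, this]
  simp
end

section
/- For all integers m ≥ 1, d ≥ 1, n ≥ 0 and any d-contact stack S on [n], S is m-regular (every arc (i,j) ∈ S has j − i ≥ m) if and only if the DLU path η(S) is m-regular, i.e., η(S) contains no subpath of the form U P D with P ∈ {∅, L^d, L^{2d}, …, L^{(m−2)d}}. -/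
theorem ud_infix_iff (K : ℕ) (w : List DStep) :
    ([DStep.U] ++ List.replicate K DStep.L ++ [DStep.D]) <:+: w ↔
      ∃ q, w[q]? = some DStep.U ∧ (∀ j < K, w[q + 1 + j]? = some DStep.L) ∧
        w[q + 1 + K]? = some DStep.D := by
  rw [List.infix_iff_getElem?]
  constructor
  · rintro ⟨q, hq, h⟩
    refine ⟨q, ?_, ?_, ?_⟩
    · have := h 0 (by simp)
      simpa using this
    · intro j hj
      have := h (j + 1) (by simp; omega)
      rw [show q + 1 + j = j + 1 + q by omega, this]
      simp [List.getElem_append, hj]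
    · have := h (K + 1) (by simp)
      rw [show q + 1 + K = K + 1 + q by omega, this]
      simp [List.getElem_append]
  · rintro ⟨q, h0, h1, h2⟩
    have hlen : q + 1 + K < w.length := by
      by_contra hc
      rw [List.getElem?_eq_none (by omega)] at h2
      cases h2
    refine ⟨q, by simp; omega, ?_⟩
    intro i hi
    simp at hi
    rcases Nat.eq_zero_or_pos i with rfl | hpos
    · simpa using h0
    · obtain ⟨j, rfl⟩ : ∃ j, i = j + 1 := ⟨i - 1, by omega⟩
      rw [show j + 1 + q = q + 1 + j by omega]
      by_cases hj : j < K
      · rw [h1 j hj]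
        simp [List.getElem_append, hj]
      · obtain rfl : j = K := by omega
        rw [h2]
        simp [List.getElem_append]

theorem flatMap_getElem (d : ℕ) (f : ℕ → List DStep) (hf : ∀ i, (f i).length = d) (n : ℕ) :
    ((List.range n).flatMap f).length = d * n ∧
    ∀ i < n, ∀ r < d, ((List.range n).flatMap f)[d * i + r]? = (f i)[r]? := by
  induction n with
  | zero => simp
  | succ n ih =>
    obtain ⟨hl, ih⟩ := ih
    rw [List.range_succ, List.flatMap_append]
    refine ⟨by simp [List.length_append, hl, hf]; ring, ?_⟩
    intro i hi r hr
    by_cases h : i < n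
    · have : d * i + r < d * n := by
        have : d * (i + 1) ≤ d * n := Nat.mul_le_mul_left d h
        linarith
      rw [List.getElem?_append_left (by rw [hl]; exact this)]
      exact ih i h r hr
    · obtain rfl : i = n := by omega
      rw [List.getElem?_append_right (by rw [hl]; omega), hl]
      simp

theorem piece_get (a b c r : ℕ) (x : DStep) :
    (List.replicate a DStep.D ++ List.replicate b DStep.L ++ List.replicate c DStep.U)[r]? = some x ↔
      (r < a ∧ x = DStep.D) ∨ (a ≤ r ∧ r < a + b ∧ x = DStep.L) ∨
        (a + b ≤ r ∧ r < a + b + c ∧ x = DStep.U) := by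
  simp only [List.getElem?_append, List.getElem?_replicate, List.length_append,
    List.length_replicate]
  split_ifs <;> simp <;> grind

theorem deg_add_le (d n : ℕ) (S : Finset (ℕ × ℕ)) (hS : IsContactStack d n S) (v : ℕ) :
    ldeg S v + rdeg S v ≤ d := by
  refine le_trans (le_of_eq ?_) (hS.2.2 v)
  unfold ldeg rdeg
  rw [add_comm, ← Finset.card_union_of_disjoint, Finset.filter_union_right]
  rw [Finset.disjoint_filter]
  intro p hp h1 h2
  have := (hS.1 p hp).2.1
  omega

theorem eta_get (d n : ℕ) (S : Finset (ℕ × ℕ)) (hS : IsContactStack d n S) (i : ℕ) (hi : i < n)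
    (r : ℕ) (hr : r < d) (x : DStep) :
    (eta d n S)[d * i + r]? = some x ↔
      (r < ldeg S (i + 1) ∧ x = DStep.D) ∨
      (ldeg S (i + 1) ≤ r ∧ r + rdeg S (i + 1) < d ∧ x = DStep.L) ∨
      (d ≤ r + rdeg S (i + 1) ∧ x = DStep.U) := by
  have hdeg := deg_add_le d n S hS
  unfold eta
  rw [(flatMap_getElem d _ (fun i => by
    have := hdeg (i + 1)
    simp; omega) n).2 i hi r hr, piece_get]
  have := hdeg (i + 1)
  grind

theorem eta_length (d n : ℕ) (S : Finset (ℕ × ℕ)) (hS : IsContactStack d n S) :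
    (eta d n S).length = d * n := by
  have hdeg := deg_add_le d n S hS
  unfold eta
  exact (flatMap_getElem d _ (fun i => by
    have := hdeg (i + 1)
    simp; omega) n).1

theorem ldeg_pos (S : Finset (ℕ × ℕ)) (v : ℕ) : 0 < ldeg S v ↔ ∃ u, (u, v) ∈ S := by
  unfold ldeg
  rw [Finset.card_pos]
  constructor
  · rintro ⟨⟨a, b⟩, h⟩
    rw [Finset.mem_filter] at h
    obtain ⟨h, rfl⟩ := h
    exact ⟨a, h⟩
  · rintro ⟨u, h⟩
    exact ⟨(u, v), by simp [h]⟩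

theorem rdeg_pos (S : Finset (ℕ × ℕ)) (v : ℕ) : 0 < rdeg S v ↔ ∃ u, (v, u) ∈ S := by
  unfold rdeg
  rw [Finset.card_pos]
  constructor
  · rintro ⟨⟨a, b⟩, h⟩
    rw [Finset.mem_filter] at h
    obtain ⟨h, rfl⟩ := h
    exact ⟨b, h⟩
  · rintro ⟨u, h⟩
    exact ⟨(v, u), by simp [h]⟩

/-- A short subpath of `η(S)` corresponds to consecutive pieces. -/
theorem short_iff (d n : ℕ) (hd : 1 ≤ d) (S : Finset (ℕ × ℕ)) (hS : IsContactStack d n S) (k : ℕ) :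
    ([DStep.U] ++ List.replicate (k * d) DStep.L ++ [DStep.D]) <:+: eta d n S ↔
      ∃ i, i + 1 + k < n ∧ 0 < rdeg S (i + 1) ∧
        (∀ j < k, ldeg S (i + 1 + j + 1) = 0 ∧ rdeg S (i + 1 + j + 1) = 0) ∧
        0 < ldeg S (i + 1 + k + 1) := by
  have hlen := eta_length d n S hS
  rw [ud_infix_iff]
  constructor
  · rintro ⟨q, h0, h1, h2⟩
    have hlt : q + 1 + k * d < d * n := by
      by_contra hc
      rw [List.getElem?_eq_none (by omega)] at h2
      cases h2
    obtain ⟨i, r, hr, rfl⟩ : ∃ i r, r < d ∧ q = d * i + r :=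
      ⟨q / d, q % d, Nat.mod_lt _ hd, (Nat.div_add_mod q d).symm⟩
    have hi : i < n := by
      by_contra hc
      have := Nat.mul_le_mul_left d (Nat.le_of_not_lt hc)
      omega
    have hU := (eta_get d n S hS i hi r hr _).1 h0
    simp at hU
    have hrd : r + 1 = d := by
      by_contra hne
      have hr1 : r + 1 < d := by omega
      have hU1 : (eta d n S)[d * i + (r + 1)]? = some DStep.U :=
        (eta_get d n S hS i hi (r + 1) hr1 _).2 (Or.inr (Or.inr ⟨by omega, rfl⟩))
      rw [← add_assoc] at hU1
      rcases Nat.eq_zero_or_pos (k * d) with hk | hk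
      · rw [hk, add_zero, hU1] at h2
        cases h2
      · have := h1 0 hk
        rw [add_zero, hU1] at this
        cases this
    have hq : d * i + r + 1 = d * (i + 1) := by rw [mul_add]; omega
    rw [hq] at h1 h2 hlt
    have hn : i + 1 + k < n := by
      have : d * (i + 1 + k) < d * n := by
        calc _ = d * (i + 1) + k * d := by ring
          _ < _ := hlt
      exact Nat.lt_of_mul_lt_mul_left this
    refine ⟨i, hn, by omega, ?_, ?_⟩
    · intro j hj
      have hjd : d * j + d ≤ k * d := by
        calc d * j + d = (j + 1) * d := by ring
          _ ≤ k * d := Nat.mul_le_mul_right d hj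
      have key : ∀ s < d, (eta d n S)[d * (i + 1 + j) + s]? = some DStep.L := by
        intro s hs
        have := h1 (d * j + s) (by omega)
        rw [← this]
        congr 1
        ring
      have hA := (eta_get d n S hS (i + 1 + j) (by omega) 0 hd _).1 (key 0 hd)
      have hB := (eta_get d n S hS (i + 1 + j) (by omega) (d - 1) (by omega) _).1
        (key (d - 1) (by omega))
      simp at hA hB
      omega
    · rw [show d * (i + 1) + k * d = d * (i + 1 + k) + 0 by ring] at h2
      have hA := (eta_get d n S hS (i + 1 + k) hn 0 hd _).1 h2
      simpa using hA
  · rintro ⟨i, hn, hU, hL, hD⟩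
    have hq : d * i + (d - 1) + 1 = d * (i + 1) := by rw [mul_add]; omega
    refine ⟨d * i + (d - 1), ?_, ?_, ?_⟩
    · exact (eta_get d n S hS i (by omega) (d - 1) (by omega) _).2
        (Or.inr (Or.inr ⟨by omega, rfl⟩))
    · intro t ht
      obtain ⟨j, s, hs, rfl⟩ : ∃ j s, s < d ∧ t = d * j + s :=
        ⟨t / d, t % d, Nat.mod_lt _ hd, (Nat.div_add_mod t d).symm⟩
      have hj : j < k := by
        by_contra hc
        have := Nat.mul_le_mul_right d (Nat.le_of_not_lt hc)
        rw [mul_comm j d] at this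
        omega
      rw [hq, show d * (i + 1) + (d * j + s) = d * (i + 1 + j) + s by ring]
      have := hL j hj
      exact (eta_get d n S hS (i + 1 + j) (by omega) s hs _).2
        (Or.inr (Or.inl ⟨by omega, by omega, rfl⟩))
    · rw [hq, show d * (i + 1) + k * d = d * (i + 1 + k) + 0 by ring]
      exact (eta_get d n S hS (i + 1 + k) hn 0 hd _).2 (Or.inl ⟨hD, rfl⟩)

theorem stmt2 (m d n : ℕ) (hm : 1 ≤ m) (hd : 1 ≤ d) (S : Finset (ℕ × ℕ))
    (hS : IsContactStack d n S) :
    ArcsRegular m S ↔ RegularWord m d (eta d n S) := by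
  unfold RegularWord HasShortUD
  simp only [short_iff d n hd S hS]
  constructor
  · rintro hreg ⟨k, hk, i, hn, hU, hL, hD⟩
    obtain ⟨w, hw⟩ := (rdeg_pos S _).1 hU
    obtain ⟨u, hu⟩ := (ldeg_pos S _).1 hD
    have hw1 := hS.1 _ hw
    have hu1 := hS.1 _ hu
    have hcr := hS.2.1 _ hu _ hw
    have hrw := hreg _ hw
    have hru := hreg _ hu
    simp only at hw1 hu1 hcr hrw hru
    omega
  · intro hno
    by_contra hreg
    unfold ArcsRegular at hreg
    push Not at hreg
    obtain ⟨p, hp, hpm⟩ := hreg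
    obtain ⟨⟨a, b⟩, hab, hmin⟩ := Finset.exists_min_image S (fun p => p.2 - p.1) ⟨p, hp⟩
    have hle := hmin p hp
    have h1 := hS.1 _ hab
    simp only at hle h1
    refine hno ⟨b - a - 1, by omega, a - 1, by omega, ?_, ?_, ?_⟩
    · rw [show a - 1 + 1 = a by omega]
      exact (rdeg_pos S a).2 ⟨b, hab⟩
    · intro j hj
      constructor
      · by_contra hne
        obtain ⟨u, hu⟩ := (ldeg_pos S _).1 (Nat.pos_of_ne_zero hne)
        have hu1 := hS.1 _ hu
        have hu2 := hmin _ hu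
        have hcr := hS.2.1 _ hu _ hab
        simp only at hu1 hu2 hcr
        omega
      · by_contra hne
        obtain ⟨u, hu⟩ := (rdeg_pos S _).1 (Nat.pos_of_ne_zero hne)
        have hu1 := hS.1 _ hu
        have hu2 := hmin _ hu
        have hcr := hS.2.1 _ hab _ hu
        simp only at hu1 hu2 hcr
        omega
    · rw [show a - 1 + 1 + (b - a - 1) + 1 = b by omega]
      exact (ldeg_pos S b).2 ⟨a, hab⟩
end

section
/- For all integers m ≥ 1, d ≥ 1 and n ≥ 0: a^{⟨1,1⟩}_{m,d}(dn) = g^{⟨0,0⟩}_{m,d}(dn) − 1 if 0 ≤ n ≤ m − 2, and a^{⟨1,1⟩}_{m,d}(dn) = g^{⟨0,0⟩}_{m,d}(dn) if n ≥ m − 1. Equivalently, as formal power series, A^{⟨1,1⟩}_{m,d}(x) = G^{⟨0,0⟩}_{m,d}(x) − C_{m,d}(x) where C_{m,d}(x) = Σ_{k=0}^{m−2} x^{dk}. -/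
open DStep in
theorem aux_infix_L (p : ℕ) (w X : List DStep) :
    (U :: w) <:+: (List.replicate p L ++ X) ↔ (U :: w) <:+: X := by
  induction p with
  | zero => simp
  | succ p ih =>
    rw [List.replicate_succ, List.cons_append, List.infix_cons_iff, ih]
    simp [List.cons_prefix_cons]

open DStep in
theorem aux_infix_R (q : ℕ) (w X : List DStep) :
    (w ++ [D]) <:+: (X ++ List.replicate q L) ↔ (w ++ [D]) <:+: X := by
  induction q with
  | zero => simp
  | succ q ih =>
    rw [List.replicate_succ', ← List.append_assoc, List.infix_concat_iff, ih]
    refine or_iff_right ?_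
    rintro ⟨Y, h⟩
    rw [← List.append_assoc] at h
    have := (List.append_inj' h rfl).2
    simp at this

open DStep in
theorem aux_split_L (p : ℕ) : ∀ (pre R X : List DStep),
    pre ++ U :: R = List.replicate p L ++ X →
      ∃ pre', pre = List.replicate p L ++ pre' ∧ pre' ++ U :: R = X := by
  induction p with
  | zero => intro pre R X h; exact ⟨pre, by simp, by simpa using h⟩
  | succ p ih =>
    intro pre R X h
    cases pre with
    | nil => simp [List.replicate_succ] at h
    | cons a pre =>
      simp only [List.replicate_succ, List.cons_append, List.cons.injEq] at h
      obtain ⟨pre', h1, h2⟩ := ih pre R X h.2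
      exact ⟨pre', by simp [List.replicate_succ, h.1, h1], h2⟩

open DStep in
theorem aux_split_R (q : ℕ) : ∀ (suf Z X : List DStep),
    Z ++ D :: suf = X ++ List.replicate q L →
      ∃ suf', suf = suf' ++ List.replicate q L ∧ Z ++ D :: suf' = X := by
  induction q with
  | zero => intro suf Z X h; exact ⟨suf, by simp, by simpa using h⟩
  | succ q ih =>
    intro suf Z X h
    rcases List.eq_nil_or_concat suf with rfl | ⟨suf, a, rfl⟩
    · rw [List.replicate_succ', ← List.append_assoc] at h
      have := (List.append_inj' h rfl).2
      simp at this
    · rw [List.replicate_succ', ← List.append_assoc, List.concat_eq_append,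
        ← List.cons_append, ← List.append_assoc] at h
      have h1 := List.append_inj' h rfl
      obtain ⟨suf', h2, h3⟩ := ih suf Z X h1.1
      refine ⟨suf', ?_, h3⟩
      rw [List.replicate_succ', List.concat_eq_append, h1.2, h2, List.append_assoc]

theorem stepSum_replicate_L (k : ℕ) : stepSum (List.replicate k DStep.L) = 0 := by
  simp [stepSum, DStep.val]

open DStep in
theorem short_hat0 (m d : ℕ) (M : List DStep) :
    HasShortUD m d (hatPath d 0 0 M) ↔ HasShortUD m d M := by
  unfold HasShortUD hatPath
  refine exists_congr fun k => and_congr_right fun _ => ?_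
  simp only [List.replicate_zero, List.append_nil, Nat.sub_zero]
  rw [aux_infix_R, List.append_assoc, List.singleton_append, aux_infix_L]

open DStep in
theorem short_hat1 (m d n : ℕ) (hd : 1 ≤ d) (M : List DStep) (hlen : M.length = d * n)
    (hsum : stepSum M = 0) (hpos : ∀ k ≤ M.length, 0 ≤ stepSum (M.take k)) :
    HasShortUD m d (hatPath d 1 1 M) ↔
      HasShortUD m d M ∨ (n + 2 ≤ m ∧ M = List.replicate (d * n) L) := by
  have key : ∀ k, ([U] ++ List.replicate (k * d) L ++ [D]) <:+: hatPath d 1 1 M ↔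
      ([U] ++ List.replicate (k * d) L ++ [D]) <:+: M ∨ M = List.replicate (k * d) L := by
    intro k
    unfold hatPath
    rw [aux_infix_R]
    simp only [List.append_assoc, List.nil_append, List.cons_append]
    rw [aux_infix_L]
    simp only [List.replicate_one, List.singleton_append]
    constructor
    · intro h
      rw [List.infix_cons_iff, ← List.cons_append, List.infix_concat_iff] at h
      rcases h with h | h | h
      · rw [List.cons_append, List.cons_prefix_cons] at h
        rw [List.prefix_concat_iff] at h
        rcases h.2 with h | ⟨Y, h⟩
        · right
          exact (List.append_inj' h rfl).1.symm
        · exfalso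
          have := hpos (k * d + 1) (by rw [← h]; simp)
          rw [← h, List.take_left' (by simp), stepSum_append, stepSum_replicate_L] at this
          simp [stepSum, DStep.val] at this
      · exfalso
        rw [List.suffix_concat_iff] at h
        rcases h with h | ⟨t, h1, X, h2⟩
        · simp at h
        · have h3 := (List.append_inj' h1 rfl).1
          subst h3
          have := hpos X.length (by rw [← h2]; simp)
          rw [← h2] at this hsum
          rw [List.take_left' rfl] at this
          have e : stepSum (U :: List.replicate (k * d) L) = 1 := by
            simp [stepSum, DStep.val]
          rw [stepSum_append, e] at hsum
          omega
      · left; simpa using h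
    · rintro (h | h)
      · exact h.trans ⟨[U], [D], by simp⟩
      · rw [h]
  constructor
  · rintro ⟨k, hk, h⟩
    rcases (key k).1 h with h | h
    · exact Or.inl ⟨k, hk, h⟩
    · right
      have h' := congrArg List.length h
      rw [hlen, List.length_replicate, mul_comm] at h'
      have : n = k := Nat.eq_of_mul_eq_mul_right hd h'
      subst this
      exact ⟨hk, by rw [h, mul_comm]⟩
  · rintro (⟨k, hk, h⟩ | ⟨hn, h⟩)
    · exact ⟨k, hk, (key k).2 (Or.inl h)⟩
    · exact ⟨n, hn, (key n).2 (Or.inr (by rw [h, mul_comm]))⟩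

open DStep in
theorem lambda_hat0 (d : ℕ) (M : List DStep) :
    HasLambda d (hatPath d 0 0 M) ↔ HasLambda d M := by
  unfold hatPath
  simp only [List.replicate_zero, List.append_nil, Nat.sub_zero]
  constructor
  · rintro ⟨pre, P, suf, h, h1, h2, h3, h4⟩
    have h' : pre ++ U :: (U :: (P ++ D :: D :: suf)) =
        List.replicate d L ++ (M ++ List.replicate d L) := by simpa using h.symm
    obtain ⟨pre', rfl, e⟩ := aux_split_L _ _ _ _ h'
    have e' : (pre' ++ U :: U :: (P ++ [D])) ++ D :: suf = M ++ List.replicate d L := by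
      simpa using e
    obtain ⟨suf', rfl, e2⟩ := aux_split_R _ _ _ _ e'
    refine ⟨pre', P, suf', by simpa using e2.symm, ?_, ?_, h3, h4⟩
    · simpa [add_assoc] using h1
    · simpa [add_assoc] using h2
  · rintro ⟨pre, P, suf, h, h1, h2, h3, h4⟩
    refine ⟨List.replicate d L ++ pre, P, suf ++ List.replicate d L, by simp [h], ?_, ?_, h3, h4⟩
    · simpa [add_assoc] using h1
    · simpa [add_assoc] using h2

open DStep in
theorem lambda_hat1 (d n : ℕ) (hd : 1 ≤ d) (M : List DStep) (hlen : M.length = d * n) :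
    HasLambda d (hatPath d 1 1 M) ↔ HasLambda d M := by
  unfold hatPath
  have hd1 : d - 1 + 1 = d := by omega
  constructor
  · rintro ⟨pre, P, suf, h, h1, h2, h3, h4⟩
    have h' : pre ++ U :: (U :: (P ++ D :: D :: suf)) =
        List.replicate (d - 1) L ++ (U :: (M ++ D :: List.replicate (d - 1) L)) := by
      simpa using h.symm
    obtain ⟨pre', rfl, e⟩ := aux_split_L _ _ _ _ h'
    cases pre' with
    | nil => simp [hd1] at h1
    | cons a pre' =>
      simp only [List.cons_append, List.cons.injEq] at e
      have e' : (pre' ++ U :: U :: (P ++ [D])) ++ D :: suf =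
          (M ++ [D]) ++ List.replicate (d - 1) L := by
        simpa using e.2
      obtain ⟨suf', rfl, e2⟩ := aux_split_R _ _ _ _ e'
      have l1 : (List.replicate (d - 1) L ++ a :: pre').length = d + pre'.length := by
        simp; omega
      rw [l1] at h1 h2
      rw [add_assoc, Nat.add_mod_left] at h1
      rw [add_assoc, add_assoc, Nat.add_mod_left, ← add_assoc] at h2
      rcases List.eq_nil_or_concat suf' with rfl | ⟨suf', b, rfl⟩
      · exfalso
        have l2 := congrArg List.length e2
        simp [hlen] at l2
        apply h2
        have : pre'.length + P.length + 3 = d * n := by omega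
        rw [this, Nat.mul_mod_right]
      · replace e2 : (pre' ++ U :: U :: (P ++ [D]) ++ D :: suf') ++ [b] = M ++ [D] := by
          simpa using e2
        have e3 := (List.append_inj' e2 rfl).1
        exact ⟨pre', P, suf', by simpa using e3.symm, h1, h2, h3, h4⟩
  · rintro ⟨pre, P, suf, h, h1, h2, h3, h4⟩
    have l1 : (List.replicate (d - 1) L ++ U :: pre).length = d + pre.length := by
      simp; omega
    refine ⟨List.replicate (d - 1) L ++ U :: pre, P, suf ++ D :: List.replicate (d - 1) L,
      by simp [h], ?_, ?_, h3, h4⟩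
    · rw [l1]; simpa [add_assoc] using h1
    · rw [l1]; simpa [add_assoc] using h2

open DStep in
theorem prime_iff (m d n : ℕ) (hd : 1 ≤ d) (M : List DStep) :
    IsPrimePath m d n 1 1 M ↔
      IsGoodPath m d n 0 0 M ∧ ¬ (n + 2 ≤ m ∧ M = List.replicate (d * n) L) := by
  unfold IsPrimePath IsGoodPath IsDLUPath RegularWord
  rw [short_hat0, lambda_hat0]
  constructor
  · rintro ⟨⟨⟨h1, h2, h3, h4⟩, h5, h6⟩, h7⟩
    have hs : stepSum M = 0 := by push_cast at h3; omega
    have hp : ∀ k ≤ M.length, 0 ≤ stepSum (M.take k) := fun k hk => by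
      have := h7 k hk; push_cast at this; omega
    rw [short_hat1 m d n hd M h1 hs hp] at h5
    rw [lambda_hat1 d n hd M h1] at h6
    push Not at h5
    exact ⟨⟨⟨h1, h2, by simpa using hs, by simpa using hp⟩, h5.1, h6⟩, fun h => h5.2 h.1 h.2⟩
  · rintro ⟨⟨⟨h1, h2, h3, h4⟩, h5, h6⟩, h7⟩
    have hs : stepSum M = 0 := by simpa using h3
    have hp : ∀ k ≤ M.length, 0 ≤ stepSum (M.take k) := by simpa using h4
    rw [short_hat1 m d n hd M h1 hs hp, lambda_hat1 d n hd M h1]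
    refine ⟨⟨⟨h1, h2, by simp [hs], fun k hk => ?_⟩, fun h => h.elim h5 h7, h6⟩, fun k hk => ?_⟩
    · have := hp k hk; push_cast; omega
    · have := hp k hk; push_cast; omega

open DStep in
theorem good_L (m d n : ℕ) : IsGoodPath m d n 0 0 (List.replicate (d * n) L) := by
  unfold IsGoodPath IsDLUPath RegularWord
  rw [short_hat0, lambda_hat0]
  refine ⟨⟨by simp, fun i hi => ⟨0, d, 0, by simp, ?_⟩, by simp [stepSum_replicate_L],
    fun k _ => by simp [stepSum_replicate_L]⟩, ?_, ?_⟩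
  · have : d * i + d ≤ d * n := by
      calc d * i + d = d * (i + 1) := by ring
        _ ≤ d * n := Nat.mul_le_mul_left d hi
    have h2 : d ≤ d * n - d * i := by omega
    simp [List.drop_replicate, List.take_replicate, h2]
  · rintro ⟨k, _, h⟩
    have : U ∈ List.replicate (d * n) L := h.subset (by simp)
    simp at this
  · rintro ⟨pre, P, suf, h, _⟩
    have : U ∈ List.replicate (d * n) L := by rw [h]; simp
    simp at this

theorem good_finite (m d n : ℕ) : {M : List DStep | IsGoodPath m d n 0 0 M}.Finite := by
  have : Finite DStep := by
    exact Finite.of_surjective (fun i : Fin 3 => ![DStep.U, DStep.D, DStep.L] i)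
      (by rintro (_ | _ | _); exacts [⟨0, rfl⟩, ⟨1, rfl⟩, ⟨2, rfl⟩])
  exact (List.finite_length_eq DStep (d * n)).subset fun M hM => hM.1.1

theorem count_short (m d n : ℕ) (hd : 1 ≤ d) (h : n + 2 ≤ m) :
    (aCount m d n 1 1 : ℤ) = (gCount m d n 0 0 : ℤ) - 1 := by
  have e : {M | IsPrimePath m d n 1 1 M} =
      {M | IsGoodPath m d n 0 0 M} \ {List.replicate (d * n) DStep.L} := by
    ext M
    simp [prime_iff m d n hd M, h]
  have := Set.ncard_sdiff_singleton_add_one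
    (show List.replicate (d * n) DStep.L ∈ {M | IsGoodPath m d n 0 0 M} from good_L m d n)
    (good_finite m d n)
  unfold aCount gCount
  rw [e]
  have h2 : ({M | IsGoodPath m d n 0 0 M} \ {List.replicate (d * n) DStep.L}).ncard + 1 =
    {M | IsGoodPath m d n 0 0 M}.ncard := this
  omega

theorem count_long (m d n : ℕ) (hd : 1 ≤ d) (h : m ≤ n + 1) :
    aCount m d n 1 1 = gCount m d n 0 0 := by
  unfold aCount gCount
  congr 1
  ext M
  have : ¬ n + 2 ≤ m := by omega
  simp [prime_iff m d n hd M, this]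

theorem stmt7 (m d : ℕ) (hm : 1 ≤ m) (hd : 1 ≤ d) :
    (∀ n : ℕ,
      (n + 2 ≤ m → (aCount m d n 1 1 : ℤ) = (gCount m d n 0 0 : ℤ) - 1) ∧
      (m ≤ n + 1 → aCount m d n 1 1 = gCount m d n 0 0)) ∧
    Aps m d 1 1 = Gps m d 0 0 - Cps m d := by
  refine ⟨fun n => ⟨count_short m d n hd, count_long m d n hd⟩, ?_⟩
  ext N
  simp only [Aps, Gps, Cps, map_sub, map_sum, PowerSeries.coeff_mk, PowerSeries.coeff_X_pow]
  by_cases hN : d ∣ N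
  · obtain ⟨n, rfl⟩ := hN
    have hc : ∀ k, (d * n = d * k) ↔ n = k := fun k => Nat.mul_right_inj (by omega)
    simp only [hc, dvd_mul_right, if_true, Nat.mul_div_cancel_left n hd, Finset.sum_ite_eq,
      Finset.mem_range]
    by_cases h : n + 2 ≤ m
    · rw [count_short m d n hd h, if_pos (by omega)]
    · rw [count_long m d n hd (by omega), if_neg (by omega), sub_zero]
  · have hc : ∀ k, ¬ (N = d * k) := fun k hk => hN ⟨k, hk⟩
    simp [hN, hc]
end
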